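/- arXiv:1405.4569 — 4 statements merged into one kernel-verified Lean document; each statement's English description precedes it below -/
import Mathlib

section
/- Sufficient conditions for a 1D Dirac point: linear band crossing. Let V be an even-index cosine potential, E⋆ ∈ ℝ, and let Φ₁ be Dirac point data for V with λ♯ := 2i ∫₀¹ conj(Φ₁) Φ₁′ ≠ 0. Then there exist ζ₀ > 0, smooth real-valued functions E₊, E₋ defined on (π − ζ₀, π + ζ₀), and smooth functions η₊, η₋ defined on (−ζ₀, ζ₀) with η₊(0) = η₋(0) = 0, such that for every k with |k − π| < ζ₀: (i) E₊(k) − E⋆ = +λ♯ (k − π)(1 + η₊(k − π)) and E₋(k) − E⋆ = −λ♯ (k − π)(1 + η₋(k − π)); (ii) for each sign ± there is a twice continuously differentiable Φ±(·; k) : ℝ → ℂ, not identically zero, with −Φ±″(x; k) + V(x)Φ±(x; k) = E±(k) Φ±(x; k) for all x and Φ±(x + 1; k) = e^{ik} Φ±(x; k) for all x. -/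
open MeasureTheory Filter

open Topology BoundedContinuousFunction in
theorem dp_linear_ode {E : Type*} [NormedAddCommGroup E] [NormedSpace ℝ E] [CompleteSpace E]
    (N : ℝ → E →L[ℝ] E) (hN : Continuous N) (C : ℝ) (hC : ∀ x, ‖N x‖ ≤ C) (v₀ : E) :
    ∃ Y : ℝ → ℝ → E,
      (∀ᶠ ε in 𝓝 (0:ℝ), Y ε 0 = v₀ ∧ ∀ x, HasDerivAt (Y ε) (ε • N x (Y ε x)) x) ∧
      (∀ x, AnalyticAt ℝ (fun ε => Y ε x) 0) ∧
      (∀ x, Y 0 x = v₀) ∧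
      (∀ x, HasDerivAt (fun ε => Y ε x) (∫ t in (0:ℝ)..x, N t v₀) 0) := by
  have hcosh : ∀ x : ℝ, Real.cosh x ≠ 0 := fun x => (Real.cosh_pos x).ne'
  have hC0 : 0 ≤ C := (norm_nonneg _).trans (hC 0)
  have hcont : ∀ v : ℝ →ᵇ E, Continuous fun t => Real.cosh t • N t (v t) := fun v =>
    Real.continuous_cosh.smul (hN.clm_apply v.continuous)
  have hprim : ∀ v : ℝ →ᵇ E, ∀ x, HasDerivAt (fun x => ∫ t in (0:ℝ)..x, Real.cosh t • N t (v t))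
      (Real.cosh x • N x (v x)) x := fun v x => by
    exact intervalIntegral.integral_hasDerivAt_right ((hcont v).intervalIntegrable _ _)
      ((hcont v).stronglyMeasurableAtFilter _ _) (hcont v).continuousAt
  have hb : ∀ v : ℝ →ᵇ E, ∀ x, ‖(Real.cosh x)⁻¹ • ∫ t in (0:ℝ)..x, Real.cosh t • N t (v t)‖
      ≤ C * ‖v‖ := fun v x => by
    have h1 : ‖∫ t in (0:ℝ)..x, Real.cosh t • N t (v t)‖
        ≤ |∫ t in (0:ℝ)..x, Real.cosh t * (C * ‖v‖)| := by
      apply intervalIntegral.norm_integral_le_abs_of_norm_le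
      · refine Eventually.of_forall fun t => ?_
        rw [norm_smul, Real.norm_of_nonneg (Real.cosh_pos t).le]
        gcongr
        · exact ((N t).le_opNorm _).trans (mul_le_mul (hC t) (v.norm_coe_le_norm t)
            (norm_nonneg _) hC0)
      · exact (Continuous.intervalIntegrable (by fun_prop) _ _)
    have h2 : ∫ t in (0:ℝ)..x, Real.cosh t * (C * ‖v‖) = Real.sinh x * (C * ‖v‖) := by
      rw [intervalIntegral.integral_mul_const]
      congr 1
      rw [intervalIntegral.integral_eq_sub_of_hasDerivAt (f := Real.sinh)
        (fun t _ => Real.hasDerivAt_sinh t) (Real.continuous_cosh.intervalIntegrable _ _)]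
      simp
    have hcv : 0 ≤ C * ‖v‖ := by positivity
    rw [h2, abs_mul, abs_of_nonneg hcv] at h1
    have h3 : |Real.sinh x| ≤ Real.cosh x := by
      refine abs_le_of_sq_le_sq ?_ (Real.cosh_pos x).le
      nlinarith [Real.cosh_sq x]
    rw [norm_smul, norm_inv, Real.norm_of_nonneg (Real.cosh_pos x).le,
      inv_mul_le_iff₀ (Real.cosh_pos x)]
    exact h1.trans (mul_le_mul_of_nonneg_right h3 hcv)
  let T₀ : (ℝ →ᵇ E) →ₗ[ℝ] (ℝ →ᵇ E) :=
    { toFun := fun v => BoundedContinuousFunction.ofNormedAddCommGroup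
        (fun x => (Real.cosh x)⁻¹ • ∫ t in (0:ℝ)..x, Real.cosh t • N t (v t))
        ((Real.continuous_cosh.inv₀ hcosh).smul
          (continuous_iff_continuousAt.2 fun x => (hprim v x).continuousAt)) (C * ‖v‖) (hb v)
      map_add' := fun v w => by
        ext x
        simp only [BoundedContinuousFunction.coe_ofNormedAddCommGroup,
          BoundedContinuousFunction.coe_add, Pi.add_apply, map_add, smul_add]
        rw [intervalIntegral.integral_add ((hcont v).intervalIntegrable _ _)
          ((hcont w).intervalIntegrable _ _), smul_add]
      map_smul' := fun c v => by
        ext x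
        simp only [BoundedContinuousFunction.coe_ofNormedAddCommGroup,
          BoundedContinuousFunction.coe_smul, map_smul, RingHom.id_apply]
        simp only [smul_comm _ c, intervalIntegral.integral_smul] }
  let T : (ℝ →ᵇ E) →L[ℝ] (ℝ →ᵇ E) := T₀.mkContinuous C (fun v =>
    BoundedContinuousFunction.norm_ofNormedAddCommGroup_le _ (by positivity) (hb v))
  have hT : ∀ v x, T v x = (Real.cosh x)⁻¹ • ∫ t in (0:ℝ)..x, Real.cosh t • N t (v t) :=
    fun v x => rfl
  let w₀ : ℝ →ᵇ E := BoundedContinuousFunction.ofNormedAddCommGroup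
    (fun x => (Real.cosh x)⁻¹ • v₀) ((Real.continuous_cosh.inv₀ hcosh).smul continuous_const)
    ‖v₀‖ (fun x => by
      rw [norm_smul, norm_inv, Real.norm_of_nonneg (Real.cosh_pos x).le]
      exact mul_le_of_le_one_left (norm_nonneg _) (inv_le_one_of_one_le₀ (Real.one_le_cosh x)))
  have hw₀ : ∀ x, w₀ x = (Real.cosh x)⁻¹ • v₀ := fun x => rfl
  let w : ℝ → (ℝ →ᵇ E) := fun ε => Ring.inverse (1 - ε • T) w₀
  have hlin : AnalyticAt ℝ (fun ε : ℝ => (1 - ε • T : (ℝ →ᵇ E) →L[ℝ] (ℝ →ᵇ E))) 0 :=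
    analyticAt_const.sub (analyticAt_id.smul analyticAt_const)
  have hwan : AnalyticAt ℝ w 0 := by
    have h1 : AnalyticAt ℝ (Ring.inverse : ((ℝ →ᵇ E) →L[ℝ] (ℝ →ᵇ E)) → _)
        (1 - (0:ℝ) • T) := by
      have := analyticAt_inverse (𝕜 := ℝ) (1 : ((ℝ →ᵇ E) →L[ℝ] (ℝ →ᵇ E))ˣ)
      simpa using this
    have h2 : AnalyticAt ℝ (fun ε : ℝ => Ring.inverse (1 - ε • T)) 0 :=
      AnalyticAt.comp (f := fun ε : ℝ => 1 - ε • T) h1 hlin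
    exact AnalyticAt.comp (f := fun ε : ℝ => Ring.inverse (1 - ε • T))
      ((ContinuousLinearMap.apply ℝ (ℝ →ᵇ E) w₀).analyticAt _) h2
  have hunit : ∀ᶠ ε in 𝓝 (0:ℝ), IsUnit (1 - ε • T) := by
    have := hlin.continuousAt
    refine this.eventually_mem (s := {S | IsUnit S}) (Units.isOpen.mem_nhds ?_)
    simp
  have hweq : ∀ᶠ ε in 𝓝 (0:ℝ), w ε = w₀ + ε • T (w ε) := by
    filter_upwards [hunit] with ε hε
    have h := Ring.mul_inverse_cancel _ hε
    have h' := congrArg (fun S : (ℝ →ᵇ E) →L[ℝ] (ℝ →ᵇ E) => S w₀) h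
    have h'' : w ε - ε • T (w ε) = w₀ := by simpa using h'
    rw [← h'']; abel
  have hYeq : ∀ᶠ ε in 𝓝 (0:ℝ), ∀ x, Real.cosh x • w ε x
      = v₀ + ε • ∫ t in (0:ℝ)..x, Real.cosh t • N t (w ε t) := by
    filter_upwards [hweq] with ε hε x
    have := congrArg (fun f : ℝ →ᵇ E => Real.cosh x • f x) hε
    simp only [BoundedContinuousFunction.coe_add, BoundedContinuousFunction.coe_smul,
      Pi.add_apply, hT, hw₀, smul_add] at this
    rw [this, smul_inv_smul₀ (hcosh x), smul_comm (Real.cosh x) ε, smul_inv_smul₀ (hcosh x)]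
  have hev : ∀ x, AnalyticAt ℝ (fun ε => w ε x) 0 := fun x =>
    ((BoundedContinuousFunction.evalCLM ℝ x).analyticAt _).fun_comp hwan
  refine ⟨fun ε x => Real.cosh x • w ε x, ?_, ?_, ?_, ?_⟩
  · filter_upwards [hYeq] with ε hε
    refine ⟨by simpa using hε 0, fun x => ?_⟩
    have h1 := ((hprim (w ε) x).const_smul ε).const_add v₀
    have h2 : (fun x => Real.cosh x • w ε x) =
      fun x => v₀ + ε • ∫ t in (0:ℝ)..x, Real.cosh t • N t (w ε t) := funext hε
    rw [h2]
    simpa using h1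
  · intro x
    exact analyticAt_const.smul (hev x)
  · intro x
    simpa using hYeq.self_of_nhds x
  · intro x
    have hg : AnalyticAt ℝ (fun ε => Real.cosh x • T (w ε) x) 0 :=
      analyticAt_const.smul (((BoundedContinuousFunction.evalCLM ℝ x).analyticAt _).fun_comp
        ((T.analyticAt _).fun_comp hwan))
    have hg' : (fun ε => Real.cosh x • T (w ε) x) =
      fun ε => ∫ t in (0:ℝ)..x, Real.cosh t • N t (w ε t) := by
      funext ε
      rw [hT, smul_inv_smul₀ (hcosh x)]
    rw [hg'] at hg
    have h1 := ((hasDerivAt_id (0:ℝ)).smul hg.differentiableAt.hasDerivAt).const_add v₀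
    have h2 := h1.congr_of_eventuallyEq (f₁ := fun ε => Real.cosh x • w ε x)
      (hYeq.mono fun ε hε => hε x)
    convert h2 using 1
    simp only [id, zero_smul, one_smul, zero_add]
    refine intervalIntegral.integral_congr fun t _ => ?_
    have := hYeq.self_of_nhds t
    simp only [← map_smul, this, zero_smul, add_zero]

theorem dp_wronskian (s : ℂ) (p q A B a b : ℝ → ℂ)
    (hA : ∀ x, HasDerivAt A (s * q x * (A x * p x + B x * q x)) x)
    (hB : ∀ x, HasDerivAt B (-s * p x * (A x * p x + B x * q x)) x)
    (ha : ∀ x, HasDerivAt a (s * q x * (a x * p x + b x * q x)) x)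
    (hb : ∀ x, HasDerivAt b (-s * p x * (a x * p x + b x * q x)) x) (x : ℝ) :
    A x * b x - B x * a x = A 0 * b 0 - B 0 * a 0 := by
  have h : ∀ x, HasDerivAt (fun x => A x * b x - B x * a x) 0 x := fun x => by
    refine HasDerivAt.congr_deriv (((hA x).mul (hb x)).sub ((hB x).mul (ha x))) ?_
    ring
  exact is_const_of_deriv_eq_zero (fun x => (h x).differentiableAt) (fun x => (h x).deriv) x 0

theorem dp_floquet (V p q p' q' a₁ b₁ a₂ b₂ : ℝ → ℂ) (E ε J ρ D : ℂ) (hJ : J ≠ 0)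
    (hV : Continuous V)
    (hp : ∀ x, HasDerivAt p (p' x) x) (hp' : ∀ x, HasDerivAt p' ((V x - E) * p x) x)
    (hq : ∀ x, HasDerivAt q (q' x) x) (hq' : ∀ x, HasDerivAt q' ((V x - E) * q x) x)
    (hW : ∀ x, p x * q' x - q x * p' x = J)
    (hps : ∀ x, p (x + 1/2) = - q x) (hqs : ∀ x, q (x + 1/2) = p x)
    (ha₁ : ∀ x, HasDerivAt a₁ (ε / J * q x * (a₁ x * p x + b₁ x * q x)) x)
    (hb₁ : ∀ x, HasDerivAt b₁ (-(ε / J) * p x * (a₁ x * p x + b₁ x * q x)) x)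
    (ha₂ : ∀ x, HasDerivAt a₂ (ε / J * q x * (a₂ x * p x + b₂ x * q x)) x)
    (hb₂ : ∀ x, HasDerivAt b₂ (-(ε / J) * p x * (a₂ x * p x + b₂ x * q x)) x)
    (ha₁0 : a₁ 0 = 1) (hb₁0 : b₁ 0 = 0) (ha₂0 : a₂ 0 = 0) (hb₂0 : b₂ 0 = 1)
    (hD : D = b₁ (1/2) - a₂ (1/2)) (hρ : ρ ^ 2 - D * ρ + 1 = 0) :
    ∃ Φ : ℝ → ℂ, ContDiff ℝ 2 Φ ∧ Φ ≠ 0 ∧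
      (∀ x, -(deriv (deriv Φ) x) + V x * Φ x = (E + ε) * Φ x) ∧
      (∀ x, Φ (x + 1) = ρ ^ 2 * Φ x) := by
  have hdet : ∀ x, a₁ x * b₂ x - b₁ x * a₂ x = 1 := fun x => by
    rw [dp_wronskian (ε / J) p q a₁ b₁ a₂ b₂ ha₁ hb₁ ha₂ hb₂ x, ha₁0, hb₁0, ha₂0, hb₂0]; ring
  obtain ⟨v, hv0, hv⟩ := (Matrix.exists_mulVec_eq_zero_iff
    (M := !![b₁ (1/2) - ρ, b₂ (1/2); -a₁ (1/2), -a₂ (1/2) - ρ])).2 (by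
      rw [Matrix.det_fin_two_of]
      linear_combination hρ + ρ * hD + hdet (1/2))
  have hv1 := congrFun hv 0
  have hv2 := congrFun hv 1
  simp [Matrix.mulVec, dotProduct, Fin.sum_univ_two] at hv1 hv2
  obtain ⟨α, hα⟩ : ∃ α, α = v 0 := ⟨_, rfl⟩
  obtain ⟨β, hβ⟩ : ∃ β, β = v 1 := ⟨_, rfl⟩
  rw [← hα, ← hβ] at hv1 hv2
  have hαβ : ¬ (α = 0 ∧ β = 0) := by
    rintro ⟨h1, h2⟩
    apply hv0
    funext i
    fin_cases i
    · simp [← hα, h1]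
    · simp [← hβ, h2]
  let a : ℝ → ℂ := fun x => α * a₁ x + β * a₂ x
  let b : ℝ → ℂ := fun x => α * b₁ x + β * b₂ x
  have ha : ∀ x, HasDerivAt a (ε / J * q x * (a x * p x + b x * q x)) x := fun x => by
    refine HasDerivAt.congr_deriv (((ha₁ x).const_mul α).add ((ha₂ x).const_mul β)) ?_
    simp only [a, b]; ring
  have hb : ∀ x, HasDerivAt b (-(ε / J) * p x * (a x * p x + b x * q x)) x := fun x => by
    refine HasDerivAt.congr_deriv (((hb₁ x).const_mul α).add ((hb₂ x).const_mul β)) ?_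
    simp only [a, b]; ring
  have ha0 : a 0 = α := by simp [a, ha₁0, ha₂0]
  have hb0 : b 0 = β := by simp [b, hb₁0, hb₂0]
  let A : ℝ → ℂ := fun x => b (x + 1/2) - ρ * a x
  let B : ℝ → ℂ := fun x => -a (x + 1/2) - ρ * b x
  have hA : ∀ x, HasDerivAt A (ε / J * q x * (A x * p x + B x * q x)) x := fun x => by
    refine HasDerivAt.congr_deriv (((hb (x + 1/2)).comp_add_const x (1/2)).sub ((ha x).const_mul ρ)) ?_
    rw [hps, hqs]
    simp only [A, B]; ring
  have hB : ∀ x, HasDerivAt B (-(ε / J) * p x * (A x * p x + B x * q x)) x := fun x => by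
    refine HasDerivAt.congr_deriv (((ha (x + 1/2)).comp_add_const x (1/2)).neg.sub ((hb x).const_mul ρ)) ?_
    rw [hps, hqs]
    simp only [A, B]; ring
  have hA0 : A 0 = 0 := by
    simp only [A, ha0, zero_add, b, one_div]
    linear_combination hv1
  have hB0 : B 0 = 0 := by
    simp only [B, hb0, zero_add, a, one_div]
    linear_combination hv2
  have hw1 : ∀ x, A x * b₁ x - B x * a₁ x = 0 := fun x => by
    rw [dp_wronskian (ε / J) p q A B a₁ b₁ hA hB ha₁ hb₁ x, hA0, hB0]; ring
  have hw2 : ∀ x, A x * b₂ x - B x * a₂ x = 0 := fun x => by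
    rw [dp_wronskian (ε / J) p q A B a₂ b₂ hA hB ha₂ hb₂ x, hA0, hB0]; ring
  have hAz : ∀ x, A x = 0 := fun x => by
    linear_combination a₁ x * hw2 x - a₂ x * hw1 x - A x * hdet x
  have hBz : ∀ x, B x = 0 := fun x => by
    linear_combination b₁ x * hw2 x - b₂ x * hw1 x - B x * hdet x
  let u : ℝ → ℂ := fun x => a x * p x + b x * q x
  have hu : ∀ x, HasDerivAt u (a x * p' x + b x * q' x) x := fun x => by
    refine HasDerivAt.congr_deriv (((ha x).mul (hp x)).add ((hb x).mul (hq x))) ?_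
    ring
  have hu' : ∀ x, HasDerivAt (fun x => a x * p' x + b x * q' x) ((V x - E - ε) * u x) x :=
    fun x => by
    refine HasDerivAt.congr_deriv (((ha x).mul (hp' x)).add ((hb x).mul (hq' x))) ?_
    simp only [u]
    have h := hW x
    have h3 : ε / J * J = ε := div_mul_cancel₀ _ hJ
    linear_combination -(a x * p x + b x * q x) * (ε / J * h + h3)
  have hdu : deriv u = fun x => a x * p' x + b x * q' x := funext fun x => (hu x).deriv
  have hddu : deriv (deriv u) = fun x => (V x - E - ε) * u x := by
    rw [hdu]; exact funext fun x => (hu' x).deriv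
  have hcu : Continuous u := continuous_iff_continuousAt.2 fun x => (hu x).continuousAt
  have hhalf : ∀ x, u (x + 1/2) = ρ * u x := fun x => by
    have h1 := hAz x
    have h2 := hBz x
    simp only [A, B] at h1 h2
    simp only [u]
    rw [hps, hqs]
    linear_combination p x * h1 + q x * h2
  refine ⟨u, ?_, ?_, ?_, ?_⟩
  · have e2 : (2 : WithTop ℕ∞) = 1 + 1 := by norm_num
    rw [e2, contDiff_succ_iff_deriv]
    refine ⟨fun x => (hu x).differentiableAt, by simp, ?_⟩
    rw [contDiff_one_iff_deriv]
    refine ⟨?_, ?_⟩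
    · rw [hdu]; exact fun x => (hu' x).differentiableAt
    · rw [hddu]; fun_prop
  · intro h0
    have h1 : ∀ x, u x = 0 := fun x => congrFun h0 x
    have h2 : a 0 * p' 0 + b 0 * q' 0 = 0 := by
      rw [← (hu 0).deriv, h0]; simp
    have h3 := h1 0
    simp only [u] at h3
    rw [ha0, hb0] at h2 h3
    apply hαβ
    constructor
    · apply (mul_eq_zero.1 (?_ : J * α = 0)).resolve_left hJ
      linear_combination -α * hW 0 + q' 0 * h3 - q 0 * h2
    · apply (mul_eq_zero.1 (?_ : J * β = 0)).resolve_left hJ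
      linear_combination -β * hW 0 - p' 0 * h3 + p 0 * h2
  · intro x
    rw [hddu]; ring
  · intro x
    have : x + 1 = x + 1/2 + 1/2 := by ring
    rw [this, hhalf, hhalf]; ring

open Topology in
theorem dp_inverse (D : ℝ → ℝ) (hD : AnalyticAt ℝ D 0) (hD0 : D 0 = 0) (lam : ℝ) (hlam : lam ≠ 0)
    (hD' : HasDerivAt D (1 / lam) 0) :
    ∃ η : ℝ → ℝ, AnalyticAt ℝ η 0 ∧ η 0 = 0 ∧
      ∀ᶠ z in 𝓝 (0:ℝ), D (lam * z * (1 + η z)) = 2 * Real.sin (z / 2) := by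
  have hne : deriv D 0 ≠ 0 := by rw [hD'.deriv]; positivity
  let g := hD.hasStrictDerivAt.localInverse _ _ _ hne
  have hg : AnalyticAt ℝ g 0 := by
    have := hD.analyticAt_localInverse hne
    rwa [hD0] at this
  have hg0 : g 0 = 0 := by
    have : g (D 0) = 0 := HasStrictFDerivAt.localInverse_apply_image ..
    rwa [hD0] at this
  have hinv : ∀ᶠ y in 𝓝 (0:ℝ), D (g y) = y := by
    have := hD.hasStrictDerivAt.eventually_right_inverse hne
    rwa [hD0] at this
  have hg' : HasDerivAt g lam 0 := by
    have h := (hD.hasStrictDerivAt.to_localInverse hne).hasDerivAt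
    rw [hD0] at h
    have h3 : (deriv D 0)⁻¹ = lam := by rw [hD'.deriv]; simp
    exact h3 ▸ h
  have hs : AnalyticAt ℝ (fun z : ℝ => 2 * Real.sin (z / 2)) 0 := by
    have : AnalyticAt ℝ (fun z : ℝ => z / 2) 0 := by fun_prop
    have h2 : AnalyticAt ℝ (fun z : ℝ => Real.sin (z / 2)) 0 :=
      AnalyticAt.comp (f := fun z : ℝ => z / 2) Real.analyticAt_sin this
    exact analyticAt_const.mul h2
  have hs' : HasDerivAt (fun z : ℝ => 2 * Real.sin (z / 2)) 1 0 := by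
    have h1 := (((hasDerivAt_id (0:ℝ)).div_const 2).sin).const_mul 2
    simpa using h1
  let e : ℝ → ℝ := fun z => g (2 * Real.sin (z / 2))
  have he : AnalyticAt ℝ e 0 :=
    AnalyticAt.comp (g := g) (f := fun z : ℝ => 2 * Real.sin (z / 2)) (by simpa using hg) hs
  have he0 : e 0 = 0 := by simp [e, hg0]
  have he' : HasDerivAt e lam 0 := by
    have := HasDerivAt.comp (h₂ := g) (h := fun z : ℝ => 2 * Real.sin (z / 2)) (0:ℝ)
      (h₂' := lam) (by simpa using hg') hs'
    rwa [mul_one] at this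
  obtain ⟨p, hp⟩ := he
  have hds : AnalyticAt ℝ (dslope e 0) 0 := hp.has_fpower_series_dslope_fslope.analyticAt
  refine ⟨fun z => dslope e 0 z / lam - 1, (hds.div analyticAt_const hlam).sub analyticAt_const,
    ?_, ?_⟩
  · simp [dslope_same, he'.deriv, hlam]
  · have hc : Tendsto (fun z : ℝ => 2 * Real.sin (z / 2)) (𝓝 0) (𝓝 0) := by
      simpa using hs.continuousAt.tendsto
    filter_upwards [hc.eventually hinv] with z hz
    have h1 : lam * z * (1 + (dslope e 0 z / lam - 1)) = e z := by
      have := sub_smul_dslope e 0 z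
      rw [he0] at this
      simp at this
      rw [← this]
      field_simp
      ring
    rw [h1]
    exact hz

open Topology in
theorem dp_discriminant (V p q p' q' : ℝ → ℝ) (E J : ℝ) (hJ : J ≠ 0)
    (hV : Continuous V)
    (hp : ∀ x, HasDerivAt p (p' x) x) (hp' : ∀ x, HasDerivAt p' ((V x - E) * p x) x)
    (hq : ∀ x, HasDerivAt q (q' x) x) (hq' : ∀ x, HasDerivAt q' ((V x - E) * q x) x)
    (hW : ∀ x, p x * q' x - q x * p' x = J)
    (hps : ∀ x, p (x + 1/2) = - q x) (hqs : ∀ x, q (x + 1/2) = p x)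
    (hnorm : ∫ t in (0:ℝ)..(1/2), (p t ^ 2 + q t ^ 2) = 1 / 2) :
    ∃ D : ℝ → ℝ, AnalyticAt ℝ D 0 ∧ D 0 = 0 ∧ HasDerivAt D (-1 / (2 * J)) 0 ∧
      ∀ᶠ ε in 𝓝 (0:ℝ), ∀ ρ : ℂ, ρ ^ 2 - (D ε : ℂ) * ρ + 1 = 0 →
        ∃ Φ : ℝ → ℂ, ContDiff ℝ 2 Φ ∧ Φ ≠ 0 ∧
          (∀ x, -(deriv (deriv Φ) x) + (V x : ℂ) * Φ x = ((E + ε : ℝ) : ℂ) * Φ x) ∧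
          (∀ x, Φ (x + 1) = ρ ^ 2 * Φ x) := by
  have hpc : Continuous p := continuous_iff_continuousAt.2 fun x => (hp x).continuousAt
  have hqc : Continuous q := continuous_iff_continuousAt.2 fun x => (hq x).continuousAt
  let N : ℝ → (ℝ × ℝ) →L[ℝ] (ℝ × ℝ) := fun x =>
    (p x • ContinuousLinearMap.fst ℝ ℝ ℝ + q x • ContinuousLinearMap.snd ℝ ℝ ℝ).smulRight
      (q x / J, -(p x / J))
  have hNapp : ∀ x w, N x w = ((p x * w.1 + q x * w.2) * (q x / J),
      (p x * w.1 + q x * w.2) * (-(p x / J))) := fun x w => by simp [N]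
  have hNc : Continuous N := by
    have h1 : Continuous fun x => (p x • ContinuousLinearMap.fst ℝ ℝ ℝ
      + q x • ContinuousLinearMap.snd ℝ ℝ ℝ) := by fun_prop
    have h2 : Continuous fun x => ((q x / J, -(p x / J)) : ℝ × ℝ) := by fun_prop
    exact ((ContinuousLinearMap.smulRightL ℝ (ℝ × ℝ) (ℝ × ℝ)).continuous.comp h1).clm_apply h2
  have hNper : Function.Periodic N 1 := fun x => by
    have hx : x + 1 = x + 1/2 + 1/2 := by ring
    have h1 : p (x + 1) = - p x := by rw [hx, hps, hqs]
    have h2 : q (x + 1) = - q x := by rw [hx, hqs, hps]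
    apply ContinuousLinearMap.ext
    intro w
    rw [hNapp, hNapp, h1, h2]
    ext <;> simp <;> ring
  obtain ⟨C, hC⟩ := (hNper.isBounded_of_continuous one_ne_zero hNc).exists_norm_le
  have hC' : ∀ x, ‖N x‖ ≤ C := fun x => hC _ ⟨x, rfl⟩
  obtain ⟨Y, hY, hYan, hY0, hYd⟩ := dp_linear_ode N hNc C hC' (1, 0)
  obtain ⟨Z, hZ, hZan, hZ0, hZd⟩ := dp_linear_ode N hNc C hC' (0, 1)
  refine ⟨fun ε => (Y ε (1/2)).2 - (Z ε (1/2)).1, ?_, ?_, ?_, ?_⟩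
  · exact (((ContinuousLinearMap.snd ℝ ℝ ℝ).analyticAt _).fun_comp (hYan (1/2))).sub
      (((ContinuousLinearMap.fst ℝ ℝ ℝ).analyticAt _).fun_comp (hZan (1/2)))
  · simp [hY0, hZ0]
  · have h1 := ((ContinuousLinearMap.snd ℝ ℝ ℝ).hasFDerivAt.comp_hasDerivAt (0:ℝ) (hYd (1/2))).sub
      ((ContinuousLinearMap.fst ℝ ℝ ℝ).hasFDerivAt.comp_hasDerivAt (0:ℝ) (hZd (1/2)))
    refine HasDerivAt.congr_deriv h1 ?_
    have hi : ∀ w, IntervalIntegrable (fun t => N t w) volume 0 (1/2) := fun w =>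
      (hNc.clm_apply continuous_const).intervalIntegrable _ _
    rw [← ContinuousLinearMap.intervalIntegral_comp_comm _ (hi _),
      ← ContinuousLinearMap.intervalIntegral_comp_comm _ (hi _),
      ← intervalIntegral.integral_sub]
    · have : ∀ t, (ContinuousLinearMap.snd ℝ ℝ ℝ) (N t (1, 0))
          - (ContinuousLinearMap.fst ℝ ℝ ℝ) (N t (0, 1)) = (-1 / J) * (p t ^ 2 + q t ^ 2) := by
        intro t
        simp [hNapp]; ring
      simp only [this]
      rw [intervalIntegral.integral_const_mul, hnorm]
      field_simp
    · exact (((ContinuousLinearMap.snd ℝ ℝ ℝ).continuous.comp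
        (hNc.clm_apply continuous_const))).intervalIntegrable _ _
    · exact (((ContinuousLinearMap.fst ℝ ℝ ℝ).continuous.comp
        (hNc.clm_apply continuous_const))).intervalIntegrable _ _
  · filter_upwards [hY, hZ] with ε hYε hZε ρ hρ
    have key : ∀ Y : ℝ → ℝ × ℝ, (∀ x, HasDerivAt Y (ε • N x (Y x)) x) →
        (∀ x, HasDerivAt (fun x => ((Y x).1 : ℂ)) ((ε:ℂ) / J * q x
          * ((Y x).1 * p x + (Y x).2 * q x)) x) ∧
        (∀ x, HasDerivAt (fun x => ((Y x).2 : ℂ)) (-((ε:ℂ) / J) * p x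
          * ((Y x).1 * p x + (Y x).2 * q x)) x) := by
      intro Y hY
      constructor
      · intro x
        have := ((ContinuousLinearMap.fst ℝ ℝ ℝ).hasFDerivAt.comp_hasDerivAt x (hY x)).ofReal_comp
        refine HasDerivAt.congr_deriv this ?_
        simp [hNapp]; ring
      · intro x
        have := ((ContinuousLinearMap.snd ℝ ℝ ℝ).hasFDerivAt.comp_hasDerivAt x (hY x)).ofReal_comp
        refine HasDerivAt.congr_deriv this ?_
        simp [hNapp]; ring
    obtain ⟨hY1, hY2⟩ := key _ hYε.2
    obtain ⟨hZ1, hZ2⟩ := key _ hZε.2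
    have := dp_floquet (fun x => (V x : ℂ)) (fun x => (p x : ℂ)) (fun x => (q x : ℂ))
      (fun x => (p' x : ℂ)) (fun x => (q' x : ℂ)) _ _ _ _ E ε J ρ _
      (by exact_mod_cast hJ) (by fun_prop)
      (fun x => (hp x).ofReal_comp) (fun x => by simpa using (hp' x).ofReal_comp)
      (fun x => (hq x).ofReal_comp) (fun x => by simpa using (hq' x).ofReal_comp)
      (fun x => by rw [← hW x]; push_cast; ring)
      (fun x => by rw [hps x]; push_cast; ring) (fun x => by rw [hqs x])
      hY1 hY2 hZ1 hZ2 (by simp [hYε.1]) (by simp [hYε.1]) (by simp [hZε.1]) (by simp [hZε.1])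
      rfl (by simpa using hρ)
    simpa using this

/-- Sufficient conditions for a 1D Dirac point: linear band crossing. -/
theorem dirac_point_linear_band_crossing
    (V : ℝ → ℝ) (hV : ContDiff ℝ (⊤ : ℕ∞) V) (hVeven : ∀ x, V (-x) = V x)
    (hVhalf : ∀ x, V (x + 1/2) = V x)
    (Estar : ℝ) (Φ₁ : ℝ → ℂ)
    (hΦ₁ : ContDiff ℝ 2 Φ₁) (hΦ₁ne : Φ₁ ≠ 0)
    (hΦ₁eq : ∀ x, -(deriv (deriv Φ₁) x) + (V x : ℂ) * Φ₁ x = (Estar : ℂ) * Φ₁ x)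
    (hΦ₁pp : ∀ x, Φ₁ (x + 1/2) = Complex.I * Φ₁ x)
    (hΦ₁norm : (∫ x in (0:ℝ)..1, ‖Φ₁ x‖ ^ 2) = 1)
    (hsimple_e : ∀ Φ : ℝ → ℂ, ContDiff ℝ 2 Φ →
      (∀ x, -(deriv (deriv Φ) x) + (V x : ℂ) * Φ x = (Estar : ℂ) * Φ x) →
      (∀ x, Φ (x + 1/2) = Complex.I * Φ x) → ∃ c : ℂ, ∀ x, Φ x = c * Φ₁ x)
    (hsimple_o : ∀ Φ : ℝ → ℂ, ContDiff ℝ 2 Φ →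
      (∀ x, -(deriv (deriv Φ) x) + (V x : ℂ) * Φ x = (Estar : ℂ) * Φ x) →
      (∀ x, Φ (x + 1/2) = -Complex.I * Φ x) → ∃ c : ℂ, ∀ x, Φ x = c * Φ₁ (-x))
    (lam : ℝ)
    (hlam : (lam : ℂ) = 2 * Complex.I * ∫ x in (0:ℝ)..1, (starRingEnd ℂ) (Φ₁ x) * deriv Φ₁ x)
    (hlamne : lam ≠ 0) :
    ∃ ζ₀ > (0:ℝ), ∃ Ep Em : ℝ → ℝ, ∃ ηp ηm : ℝ → ℝ,
      ContDiffOn ℝ (⊤ : ℕ∞) Ep (Set.Ioo (Real.pi - ζ₀) (Real.pi + ζ₀)) ∧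
      ContDiffOn ℝ (⊤ : ℕ∞) Em (Set.Ioo (Real.pi - ζ₀) (Real.pi + ζ₀)) ∧
      ContDiffOn ℝ (⊤ : ℕ∞) ηp (Set.Ioo (-ζ₀) ζ₀) ∧
      ContDiffOn ℝ (⊤ : ℕ∞) ηm (Set.Ioo (-ζ₀) ζ₀) ∧
      ηp 0 = 0 ∧ ηm 0 = 0 ∧
      ∀ k : ℝ, |k - Real.pi| < ζ₀ →
        (Ep k - Estar = lam * (k - Real.pi) * (1 + ηp (k - Real.pi))) ∧
        (Em k - Estar = -lam * (k - Real.pi) * (1 + ηm (k - Real.pi))) ∧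
        (∃ Φ : ℝ → ℂ, ContDiff ℝ 2 Φ ∧ Φ ≠ 0 ∧
          (∀ x, -(deriv (deriv Φ) x) + (V x : ℂ) * Φ x = (Ep k : ℂ) * Φ x) ∧
          (∀ x, Φ (x + 1) = Complex.exp (Complex.I * (k : ℂ)) * Φ x)) ∧
        (∃ Φ : ℝ → ℂ, ContDiff ℝ 2 Φ ∧ Φ ≠ 0 ∧
          (∀ x, -(deriv (deriv Φ) x) + (V x : ℂ) * Φ x = (Em k : ℂ) * Φ x) ∧
          (∀ x, Φ (x + 1) = Complex.exp (Complex.I * (k : ℂ)) * Φ x)) := by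
  have hP1 : ∀ x, HasDerivAt Φ₁ (deriv Φ₁ x) x := fun x =>
    (hΦ₁.differentiable (by norm_num) x).hasDerivAt
  have hdc : ContDiff ℝ 1 (deriv Φ₁) := by
    have e2 : (2 : WithTop ℕ∞) = 1 + 1 := by norm_num
    rw [e2, contDiff_succ_iff_deriv] at hΦ₁
    exact hΦ₁.2.2
  have hP2 : ∀ x, HasDerivAt (deriv Φ₁) (((V x - Estar : ℝ) : ℂ) * Φ₁ x) x := fun x => by
    refine HasDerivAt.congr_deriv (hdc.differentiable (by norm_num) x).hasDerivAt ?_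
    push_cast
    linear_combination -(hΦ₁eq x)
  have hre : ∀ {f : ℝ → ℂ} {f' : ℂ} {x : ℝ}, HasDerivAt f f' x →
      HasDerivAt (fun x => (f x).re) f'.re x := fun h =>
    Complex.reCLM.hasFDerivAt.comp_hasDerivAt _ h
  have him : ∀ {f : ℝ → ℂ} {f' : ℂ} {x : ℝ}, HasDerivAt f f' x →
      HasDerivAt (fun x => (f x).im) f'.im x := fun h =>
    Complex.imCLM.hasFDerivAt.comp_hasDerivAt _ h
  have hp : ∀ x, HasDerivAt (fun x => (Φ₁ x).re) (deriv Φ₁ x).re x := fun x => hre (hP1 x)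
  have hq : ∀ x, HasDerivAt (fun x => (Φ₁ x).im) (deriv Φ₁ x).im x := fun x => him (hP1 x)
  have hp' : ∀ x, HasDerivAt (fun x => (deriv Φ₁ x).re) ((V x - Estar) * (Φ₁ x).re) x :=
    fun x => by
      refine (hre (hP2 x)).congr_deriv ?_
      rw [Complex.re_ofReal_mul]
  have hq' : ∀ x, HasDerivAt (fun x => (deriv Φ₁ x).im) ((V x - Estar) * (Φ₁ x).im) x :=
    fun x => by
      refine (him (hP2 x)).congr_deriv ?_
      rw [Complex.im_ofReal_mul]
  -- the Wronskian of the real and imaginary parts is constant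
  have hWc : ∃ J : ℝ, ∀ x, (Φ₁ x).re * (deriv Φ₁ x).im - (Φ₁ x).im * (deriv Φ₁ x).re = J := by
    have h : ∀ x, HasDerivAt
        (fun x => (Φ₁ x).re * (deriv Φ₁ x).im - (Φ₁ x).im * (deriv Φ₁ x).re) 0 x := fun x => by
      refine HasDerivAt.congr_deriv (((hp x).mul (hq' x)).sub ((hq x).mul (hp' x))) ?_
      ring
    exact ⟨_, fun x => is_const_of_deriv_eq_zero (fun x => (h x).differentiableAt)
      (fun x => (h x).deriv) x 0⟩
  obtain ⟨J, hW⟩ := hWc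
  have hcont : Continuous Φ₁ := hΦ₁.continuous
  have hlamJ : lam = -2 * J := by
    have hint : IntervalIntegrable (fun x => (starRingEnd ℂ) (Φ₁ x) * deriv Φ₁ x) volume 0 1 :=
      ((Complex.continuous_conj.comp hcont).mul hdc.continuous).intervalIntegrable _ _
    have h1 := Complex.imCLM.intervalIntegral_comp_comm hint
    have h2 : ∀ x, Complex.imCLM ((starRingEnd ℂ) (Φ₁ x) * deriv Φ₁ x) = J := fun x => by
      rw [← hW x]
      simp [Complex.mul_im]
      ring
    simp only [h2] at h1
    have h3 := congrArg Complex.re hlam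
    simp at h1 h3
    rw [h3, h1]; ring
  have hJ : J ≠ 0 := by
    rintro rfl
    exact hlamne (by simpa using hlamJ)
  have hps : ∀ x, (Φ₁ (x + 1/2)).re = -(Φ₁ x).im := fun x => by
    rw [hΦ₁pp]; simp
  have hqs : ∀ x, (Φ₁ (x + 1/2)).im = (Φ₁ x).re := fun x => by
    rw [hΦ₁pp]; simp
  have hnorm : ∫ t in (0:ℝ)..(1/2), ((Φ₁ t).re ^ 2 + (Φ₁ t).im ^ 2) = 1 / 2 := by
    have hc : Continuous fun t => (Φ₁ t).re ^ 2 + (Φ₁ t).im ^ 2 := by fun_prop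
    have h1 : ∀ x, ‖Φ₁ x‖ ^ 2 = (Φ₁ x).re ^ 2 + (Φ₁ x).im ^ 2 := fun x => by
      rw [← Complex.normSq_eq_norm_sq, Complex.normSq_apply]; ring
    simp only [h1] at hΦ₁norm
    rw [← intervalIntegral.integral_add_adjacent_intervals
      (hc.intervalIntegrable 0 (1/2)) (hc.intervalIntegrable (1/2) 1)] at hΦ₁norm
    have h2 : ∫ t in (1/2:ℝ)..1, ((Φ₁ t).re ^ 2 + (Φ₁ t).im ^ 2)
        = ∫ t in (0:ℝ)..(1/2), ((Φ₁ t).re ^ 2 + (Φ₁ t).im ^ 2) := by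
      have h3 := intervalIntegral.integral_comp_add_right (a := (0:ℝ)) (b := 1/2)
        (fun t => (Φ₁ t).re ^ 2 + (Φ₁ t).im ^ 2) (1/2)
      simp only [hps, hqs] at h3
      norm_num at h3
      norm_num
      rw [← h3]
      refine intervalIntegral.integral_congr fun t _ => ?_
      ring
    linarith
  obtain ⟨D, hDan, hD0, hD', hD⟩ := dp_discriminant V _ _ _ _ Estar J hJ hV.continuous
    hp hp' hq hq' hW hps hqs hnorm
  have hD'' : HasDerivAt D (1 / lam) 0 := by
    refine hD'.congr_deriv ?_
    rw [hlamJ]; field_simp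
  obtain ⟨η, hηan, hη0, hη⟩ := dp_inverse D hDan hD0 lam hlamne hD''
  have hten : Tendsto (fun z => lam * z * (1 + η z)) (nhds 0) (nhds 0) := by
    have : ContinuousAt (fun z => lam * z * (1 + η z)) 0 :=
      (continuousAt_const.mul continuousAt_id).mul (continuousAt_const.add hηan.continuousAt)
    simpa [ContinuousAt] using this
  have hall := (hηan.eventually_analyticAt.and hη).and (hten.eventually hD)
  obtain ⟨r, hr, hball⟩ := Metric.eventually_nhds_iff.1 hall
  have hgood : ∀ z : ℝ, |z| < r → (AnalyticAt ℝ η z ∧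
      D (lam * z * (1 + η z)) = 2 * Real.sin (z / 2)) ∧ _ := fun z hz =>
    hball (by simpa using hz)
  have hsm : ∀ z : ℝ, |z| < r → ContDiffAt ℝ (⊤ : ℕ∞) η z := fun z hz =>
    (hgood z hz).1.1.contDiffAt
  -- the Bloch solution attached to the parameter `z` and a square root of the multiplier
  have hsol : ∀ z : ℝ, |z| < r → ∀ ρ m : ℂ, ρ ^ 2 - (2 * Real.sin (z / 2) : ℝ) * ρ + 1 = 0 →
      ρ ^ 2 = m → ∃ Φ : ℝ → ℂ, ContDiff ℝ 2 Φ ∧ Φ ≠ 0 ∧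
          (∀ x, -(deriv (deriv Φ) x) + (V x : ℂ) * Φ x
            = ((Estar + lam * z * (1 + η z) : ℝ) : ℂ) * Φ x) ∧
          (∀ x, Φ (x + 1) = m * Φ x) := by
    intro z hz ρ m hρ hm
    subst hm
    obtain ⟨⟨_, h1⟩, h2⟩ := hgood z hz
    exact h2 ρ (by rw [h1]; exact hρ)
  -- square roots of the Bloch multiplier
  have hsq : ∀ k : ℝ, (Complex.exp (Complex.I * (k / 2 : ℂ))) ^ 2
      = Complex.exp (Complex.I * (k : ℂ)) := fun k => by
    rw [← Complex.exp_nat_mul]; congr 1; push_cast; ring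
  have hquad : ∀ k : ℝ, (Complex.exp (Complex.I * (k / 2 : ℂ))) ^ 2
      + (2 * Real.sin ((k - Real.pi) / 2) : ℝ) * Complex.exp (Complex.I * (k / 2 : ℂ)) + 1 = 0 := by
    intro k
    have h1 : Real.sin ((k - Real.pi) / 2) = - Real.cos (k / 2) := by
      rw [sub_div, Real.sin_sub_pi_div_two]
    rw [h1, mul_comm Complex.I]
    push_cast
    have h2 : (Complex.cos (k / 2)) ^ 2 + Complex.sin (k / 2) ^ 2 = 1 :=
      Complex.cos_sq_add_sin_sq _
    rw [Complex.exp_mul_I]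
    linear_combination (-1 : ℂ) * h2 + (Complex.sin (k / 2)) ^ 2 * Complex.I_sq
  refine ⟨r, hr, fun k => Estar + lam * (k - Real.pi) * (1 + η (k - Real.pi)),
    fun k => Estar + lam * (-(k - Real.pi)) * (1 + η (-(k - Real.pi))), η, fun z => η (-z),
    ?_, ?_, ?_, ?_, hη0, by simpa using hη0, ?_⟩
  · intro k hk
    have hk' : |k - Real.pi| < r := by
      rw [abs_lt]; constructor <;> linarith [hk.1, hk.2]
    have h1 : ContDiffAt ℝ (⊤ : ℕ∞) (fun k => η (k - Real.pi)) k :=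
      ContDiffAt.comp (g := η) (f := fun k => k - Real.pi) k (hsm _ hk') (by fun_prop)
    apply ContDiffAt.contDiffWithinAt
    fun_prop
  · intro k hk
    have hk' : |-(k - Real.pi)| < r := by
      rw [abs_neg, abs_lt]; constructor <;> linarith [hk.1, hk.2]
    have h1 : ContDiffAt ℝ (⊤ : ℕ∞) (fun k => η (-(k - Real.pi))) k :=
      ContDiffAt.comp (g := η) (f := fun k => -(k - Real.pi)) k (hsm _ hk') (by fun_prop)
    apply ContDiffAt.contDiffWithinAt
    fun_prop
  · intro z hz
    exact (hsm z (abs_lt.2 hz)).contDiffWithinAt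
  · intro z hz
    have hz' : |-z| < r := by rw [abs_neg]; exact abs_lt.2 hz
    exact (ContDiffAt.comp (g := η) (f := fun z => -z) z (hsm _ hz')
      (by fun_prop)).contDiffWithinAt
  · intro k hk
    refine ⟨by ring, by ring, ?_, ?_⟩
    · refine hsol (k - Real.pi) hk (-Complex.exp (Complex.I * (k / 2 : ℂ))) _ ?_ ?_
      · linear_combination hquad k
      · rw [← hsq k]; ring
    · refine hsol (-(k - Real.pi)) (by rwa [abs_neg])
        (Complex.exp (Complex.I * (k / 2 : ℂ))) _ ?_ (hsq k)
      rw [neg_div, Real.sin_neg]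
      have := hquad k
      push_cast at this ⊢
      linear_combination this
end

section
/- Dirac points for small coupling. Let V be an even-index cosine potential and fix an integer n ≥ 1. Then there exist ε₀ > 0 and a continuous function ε ↦ E⋆(ε) on (−ε₀, ε₀) with E⋆(0) = π²(2n+1)², such that for every ε ∈ (−ε₀, ε₀): (i) there is a twice continuously differentiable Φ₁ : ℝ → ℂ, not identically zero, with −Φ₁″(x) + εV(x)Φ₁(x) = E⋆(ε)Φ₁(x) for all x and Φ₁(x + 1/2) = iΦ₁(x) for all x; (ii) every twice continuously differentiable solution Φ of −Φ″ + εVΦ = E⋆(ε)Φ with Φ(x + 1/2) = iΦ(x) for all x is a complex scalar multiple of Φ₁; (iii) after normalizing ∫₀¹ |Φ₁|² = 1, the quantity λ♯(ε) := 2i ∫₀¹ conj(Φ₁(x)) Φ₁′(x) dx is nonzero. -/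
open MeasureTheory Filter
open scoped Topology

theorem dp_ift (F : ℝ × ℝ → ℝ) (hF : ContDiffAt ℝ 1 F (0, 0)) (d : ℝ) (hd : d ≠ 0)
    (hder : HasDerivAt (fun t : ℝ => F (0, t)) d 0) (h0 : F (0, 0) = 0)
    (P : ℝ × ℝ → Prop) (hP : ∀ᶠ p in 𝓝 ((0, 0) : ℝ × ℝ), P p) :
    ∃ ε₀ > (0:ℝ), ∃ m : ℝ → ℝ, ContinuousOn m (Set.Ioo (-ε₀) ε₀) ∧ m 0 = 0 ∧
      ∀ ε ∈ Set.Ioo (-ε₀) ε₀, F (ε, m ε) = 0 ∧ P (ε, m ε) := by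
  have h1 : fderiv ℝ F (0, 0) (0, 1) = d := by
    have hf := (hF.differentiableAt one_ne_zero).hasFDerivAt
    have hg : HasDerivAt (fun t : ℝ => ((0 : ℝ), t)) ((0 : ℝ), (1 : ℝ)) 0 :=
      (hasDerivAt_const _ _).prodMk (hasDerivAt_id _)
    exact (hf.comp_hasDerivAt (0 : ℝ) hg).unique hder
  have hinv : (fderiv ℝ F (0, 0) ∘L .inr ℝ ℝ ℝ).IsInvertible := by
    refine ⟨ContinuousLinearEquiv.unitsEquivAut ℝ (Units.mk0 d hd), ?_⟩
    ext
    simp [h1]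
  let m := hF.implicitFunction one_ne_zero hinv
  have hm0 : m 0 = 0 := hF.implicitFunction_apply_self one_ne_zero hinv
  have hmC : ContDiffAt ℝ 1 m 0 := hF.contDiffAt_implicitFunction one_ne_zero hinv
  have e1 : ∀ᶠ x in 𝓝 (0:ℝ), F (x, m x) = F (0, 0) :=
    hF.eventually_apply_implicitFunction one_ne_zero hinv
  have e2 : ∀ᶠ x in 𝓝 (0:ℝ), ContDiffAt ℝ 1 m x := hmC.eventually (by simp)
  have e3 : ∀ᶠ x in 𝓝 (0:ℝ), P (x, m x) := by
    have : Tendsto (fun x => (x, m x)) (𝓝 (0:ℝ)) (𝓝 (0, 0)) := by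
      have := (continuousAt_id.prodMk hmC.continuousAt).tendsto
      simpa [hm0] using this
    exact this.eventually hP
  obtain ⟨r, hr, h⟩ := Metric.eventually_nhds_iff.1 (e1.and (e2.and e3))
  have hb : ∀ x ∈ Set.Ioo (-r) r, dist x 0 < r := by
    intro x hx
    rw [Real.dist_eq, sub_zero, abs_lt]; exact hx
  refine ⟨r, hr, m, fun x hx => ((h (hb x hx)).2.1.continuousAt).continuousWithinAt, hm0, ?_⟩
  intro x hx
  exact ⟨(h (hb x hx)).1.trans h0, (h (hb x hx)).2.2⟩

open BoundedContinuousFunction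

/-- Weighted primitive. -/
noncomputable def dpJfun (f : ℝ →ᵇ ℝ) : ℝ → ℝ :=
  fun x => (Real.cosh x)⁻¹ * ∫ y in (0:ℝ)..x, Real.cosh y * f y

theorem dpJfun_cont (f : ℝ →ᵇ ℝ) : Continuous (dpJfun f) := by
  unfold dpJfun
  refine Continuous.mul (Real.continuous_cosh.inv₀ fun x => (Real.cosh_pos x).ne') ?_
  exact intervalIntegral.continuous_primitive (fun a b => Continuous.intervalIntegrable (by fun_prop) _ _) _

theorem dpJfun_bound (f : ℝ →ᵇ ℝ) (x : ℝ) : ‖dpJfun f x‖ ≤ 1 * ‖f‖ := by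
  unfold dpJfun
  have h1 : ‖∫ y in (0:ℝ)..x, Real.cosh y * f y‖ ≤ |∫ y in (0:ℝ)..x, Real.cosh y * ‖f‖| := by
    apply intervalIntegral.norm_integral_le_abs_of_norm_le
    · refine Eventually.of_forall fun t => ?_
      rw [norm_mul, Real.norm_of_nonneg (Real.cosh_pos t).le]
      exact mul_le_mul_of_nonneg_left (f.norm_coe_le_norm t) (Real.cosh_pos t).le
    · exact Continuous.intervalIntegrable (by fun_prop) _ _
  have h2 : ∫ y in (0:ℝ)..x, Real.cosh y = Real.sinh x := by
    rw [intervalIntegral.integral_eq_sub_of_hasDerivAt (fun y _ => Real.hasDerivAt_sinh y)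
      (Real.continuous_cosh.intervalIntegrable _ _)]
    simp
  rw [intervalIntegral.integral_mul_const, h2, abs_mul, abs_of_nonneg (norm_nonneg f)] at h1
  have h3 : |Real.sinh x| ≤ Real.cosh x := by
    rw [abs_le]
    constructor
    · have := Real.exp_pos x; rw [← Real.cosh_add_sinh] at this; linarith
    · exact (Real.sinh_lt_cosh x).le
  have hp := Real.cosh_pos x
  rw [norm_mul, norm_inv, Real.norm_of_nonneg hp.le, inv_mul_le_iff₀ hp]
  nlinarith [norm_nonneg f, mul_le_mul_of_nonneg_right h3 (norm_nonneg f)]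

noncomputable def dpJ : (ℝ →ᵇ ℝ) →L[ℝ] (ℝ →ᵇ ℝ) :=
  LinearMap.mkContinuous
    { toFun := fun f => BoundedContinuousFunction.ofNormedAddCommGroup (dpJfun f)
        (dpJfun_cont f) _ (dpJfun_bound f)
      map_add' := by
        intro f g
        ext x
        simp only [coe_ofNormedAddCommGroup, BoundedContinuousFunction.coe_add, Pi.add_apply,
          dpJfun, mul_add]
        rw [intervalIntegral.integral_add, mul_add] <;>
          exact Continuous.intervalIntegrable (by fun_prop) _ _
      map_smul' := by
        intro r f
        ext x
        simp only [coe_ofNormedAddCommGroup, BoundedContinuousFunction.coe_smul, smul_eq_mul,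
          dpJfun, RingHom.id_apply]
        simp only [mul_left_comm _ r, intervalIntegral.integral_const_mul] }
    1 (by
      intro f
      refine (BoundedContinuousFunction.norm_le (by positivity)).2 fun x => ?_
      exact dpJfun_bound f x)

theorem dpJ_apply (f : ℝ →ᵇ ℝ) (x : ℝ) :
    dpJ f x = (Real.cosh x)⁻¹ * ∫ y in (0:ℝ)..x, Real.cosh y * f y := rfl

noncomputable def dpC (ω : ℝ) : ℝ →ᵇ ℝ :=
  BoundedContinuousFunction.ofNormedAddCommGroup (fun x => Real.cos (ω * x)) (by fun_prop) 1
    (fun x => by simpa using Real.abs_cos_le_one _)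

noncomputable def dpS (ω : ℝ) : ℝ →ᵇ ℝ :=
  BoundedContinuousFunction.ofNormedAddCommGroup (fun x => Real.sin (ω * x)) (by fun_prop) 1
    (fun x => by simpa using Real.abs_sin_le_one _)

noncomputable def dpH : ℝ →ᵇ ℝ :=
  BoundedContinuousFunction.ofNormedAddCommGroup (fun x => (Real.cosh x)⁻¹)
    (Real.continuous_cosh.inv₀ fun x => (Real.cosh_pos x).ne') 1
    (fun x => by
      rw [norm_inv, Real.norm_of_nonneg (Real.cosh_pos x).le]
      exact inv_le_one_of_one_le₀ (Real.one_le_cosh x))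

/-- Multiplication as a bilinear map. -/
noncomputable def dpMul : (ℝ →ᵇ ℝ) →L[ℝ] ((ℝ →ᵇ ℝ) →L[ℝ] (ℝ →ᵇ ℝ)) :=
  ContinuousLinearMap.mul ℝ (ℝ →ᵇ ℝ)

@[simp] theorem dpMul_apply (f g : ℝ →ᵇ ℝ) : dpMul f g = f * g := rfl

theorem dp_inv_contDiffAt {R : Type*} [NormedRing R] [NormedAlgebra ℝ R] [HasSummableGeomSeries R] :
    ContDiffAt ℝ 1 Ring.inverse (1 : R) := by
  simpa using contDiffAt_ringInverse ℝ (n := 1) (1 : Rˣ)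

theorem dp_inv_hasFDerivAt {R : Type*} [NormedRing R] [NormedAlgebra ℝ R]
    [HasSummableGeomSeries R] : HasFDerivAt Ring.inverse (-(ContinuousLinearMap.id ℝ R)) (1 : R) := by
  have := hasFDerivAt_ringInverse (𝕜 := ℝ) (1 : Rˣ)
  simp only [Units.val_one, inv_one] at this
  refine this.congr_fderiv ?_
  ext x
  simp

theorem dp_unit_nhds {R : Type*} [NormedRing R] [NormedAlgebra ℝ R] [HasSummableGeomSeries R] :
    ∀ᶠ y in 𝓝 (1 : R), IsUnit y := by
  exact Units.nhds (1 : Rˣ)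

/-- The Volterra operator. -/
noncomputable def dpK (ω : ℝ) : (ℝ →ᵇ ℝ) →L[ℝ] (ℝ →ᵇ ℝ) :=
  ω⁻¹ • (dpMul (dpS ω) ∘L dpJ ∘L dpMul (dpC ω)
    - dpMul (dpC ω) ∘L dpJ ∘L dpMul (dpS ω))

theorem dpK_apply (ω : ℝ) (f : ℝ →ᵇ ℝ) :
    dpK ω f = ω⁻¹ • (dpS ω * dpJ (dpC ω * f) - dpC ω * dpJ (dpS ω * f)) := by
  simp [dpK]

/-- A fixed point of the Volterra equation solves the ODE. -/
theorem dp_solve (ω : ℝ) (hω : ω ≠ 0) (W g : ℝ →ᵇ ℝ) (p r : ℝ)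
    (hg : g = (p • dpC ω + r • dpS ω) * dpH + dpK ω (W * g)) :
    ∃ u u' : ℝ → ℝ, (∀ x, HasDerivAt u (u' x) x) ∧
      (∀ x, HasDerivAt u' ((W x - ω ^ 2) * u x) x) ∧ u 0 = p ∧ u' 0 = ω * r ∧
      (∀ x, u x = Real.cosh x * g x) ∧
      (∀ x, u' x = ω * (-p * Real.sin (ω * x) + r * Real.cos (ω * x))
        + Real.cosh x * (Real.cos (ω * x) * dpJ (dpC ω * (W * g)) x
          + Real.sin (ω * x) * dpJ (dpS ω * (W * g)) x)) := by
  let A : ℝ → ℝ := fun x => ∫ y in (0:ℝ)..x, Real.cosh y * (dpC ω * (W * g)) y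
  let B : ℝ → ℝ := fun x => ∫ y in (0:ℝ)..x, Real.cosh y * (dpS ω * (W * g)) y
  have hA : ∀ x, HasDerivAt A (Real.cosh x * (Real.cos (ω * x) * (W x * g x))) x := fun x =>
    intervalIntegral.integral_hasDerivAt_right (Continuous.intervalIntegrable (by fun_prop) _ _)
      (Continuous.stronglyMeasurableAtFilter (by fun_prop) _ _) (Continuous.continuousAt (by fun_prop))
  have hB : ∀ x, HasDerivAt B (Real.cosh x * (Real.sin (ω * x) * (W x * g x))) x := fun x =>
    intervalIntegral.integral_hasDerivAt_right (Continuous.intervalIntegrable (by fun_prop) _ _)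
      (Continuous.stronglyMeasurableAtFilter (by fun_prop) _ _) (Continuous.continuousAt (by fun_prop))
  have hC : ∀ x, HasDerivAt (fun x => Real.cos (ω * x)) (-Real.sin (ω * x) * ω) x := fun x => by
    have := ((hasDerivAt_id x).const_mul ω).cos
    simpa using this
  have hS : ∀ x, HasDerivAt (fun x => Real.sin (ω * x)) (Real.cos (ω * x) * ω) x := fun x => by
    have := ((hasDerivAt_id x).const_mul ω).sin
    simpa using this
  have hJA : ∀ x, Real.cosh x * dpJ (dpC ω * (W * g)) x = A x := fun x => by
    rw [dpJ_apply, mul_inv_cancel_left₀ (Real.cosh_pos x).ne']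
  have hJB : ∀ x, Real.cosh x * dpJ (dpS ω * (W * g)) x = B x := fun x => by
    rw [dpJ_apply, mul_inv_cancel_left₀ (Real.cosh_pos x).ne']
  let u : ℝ → ℝ := fun x => p * Real.cos (ω * x) + r * Real.sin (ω * x)
    + ω⁻¹ * (Real.sin (ω * x) * A x - Real.cos (ω * x) * B x)
  let u' : ℝ → ℝ := fun x => ω * (-p * Real.sin (ω * x) + r * Real.cos (ω * x))
    + (Real.cos (ω * x) * A x + Real.sin (ω * x) * B x)
  have hu : ∀ x, u x = Real.cosh x * g x := by
    intro x
    have h := DFunLike.congr_fun hg x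
    rw [dpK_apply] at h
    have h' : g x = (p * Real.cos (ω * x) + r * Real.sin (ω * x)) * (Real.cosh x)⁻¹ +
      ω⁻¹ * (Real.sin (ω * x) * dpJ (dpC ω * (W * g)) x
        - Real.cos (ω * x) * dpJ (dpS ω * (W * g)) x) := h
    rw [h', mul_add]
    simp only [u]
    rw [← hJA, ← hJB]
    have := (Real.cosh_pos x).ne'
    field_simp
  refine ⟨u, u', ?_, ?_, ?_, ?_, hu, ?_⟩
  · intro x
    have := (((hC x).const_mul p).add ((hS x).const_mul r)).add
      ((((hS x).mul (hA x)).sub ((hC x).mul (hB x))).const_mul ω⁻¹)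
    refine this.congr_deriv ?_
    simp only [u']
    field_simp
    ring
  · intro x
    have := ((((hS x).const_mul (-p)).add ((hC x).const_mul r)).const_mul ω).add
      (((hC x).mul (hA x)).add ((hS x).mul (hB x)))
    refine this.congr_deriv ?_
    have e : (W x - ω ^ 2) * u x = W x * (Real.cosh x * g x) - ω ^ 2 * u x := by rw [hu]; ring
    rw [e]
    simp only [u]
    field_simp
    linear_combination (W x * (Real.cosh x * g x)) * Real.sin_sq_add_cos_sq (ω * x)
  · simp [u, A, B]
  · simp [u', A, B]
  · intro x
    simp only [u']
    rw [← hJA, ← hJB]; ring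

theorem dp_wronskian_s7 (q : ℝ → ℂ) (f f' g g' : ℝ → ℂ)
    (hf : ∀ x, HasDerivAt f (f' x) x) (hf' : ∀ x, HasDerivAt f' (q x * f x) x)
    (hg : ∀ x, HasDerivAt g (g' x) x) (hg' : ∀ x, HasDerivAt g' (q x * g x) x) (x : ℝ) :
    f x * g' x - f' x * g x = f 0 * g' 0 - f' 0 * g 0 := by
  have h : ∀ x, HasDerivAt (fun x => f x * g' x - f' x * g x) 0 x := by
    intro x
    have := ((hf x).mul (hg' x)).sub ((hf' x).mul (hg x))
    refine this.congr_deriv ?_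
    ring
  exact is_const_of_deriv_eq_zero (fun x => (h x).differentiableAt) (fun x => (h x).deriv) x 0

theorem dp_endgame (q : ℝ → ℝ) (hq : Continuous q) (hqp : ∀ x, q (x + 1/2) = q x)
    (c c' s s' : ℝ → ℝ)
    (hc : ∀ x, HasDerivAt c (c' x) x) (hc' : ∀ x, HasDerivAt c' (q x * c x) x)
    (hs : ∀ x, HasDerivAt s (s' x) x) (hs' : ∀ x, HasDerivAt s' (q x * s x) x)
    (c0 : c 0 = 1) (cp0 : c' 0 = 0) (s0 : s 0 = 0) (sp0 : s' 0 = 1)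
    (htr : c (1/2) + s' (1/2) = 0) :
    ∃ Φ₁ : ℝ → ℂ, ContDiff ℝ 2 Φ₁ ∧ Φ₁ ≠ 0 ∧
          (∀ x, deriv (deriv Φ₁) x = (q x : ℂ) * Φ₁ x) ∧
          (∀ x, Φ₁ (x + 1/2) = Complex.I * Φ₁ x) ∧
          (∀ Φ : ℝ → ℂ, ContDiff ℝ 2 Φ →
            (∀ x, deriv (deriv Φ) x = (q x : ℂ) * Φ x) →
            (∀ x, Φ (x + 1/2) = Complex.I * Φ x) → ∃ c : ℂ, ∀ x, Φ x = c * Φ₁ x) ∧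
          (∫ x in (0:ℝ)..1, ‖Φ₁ x‖ ^ 2) = 1 ∧
          2 * Complex.I * (∫ x in (0:ℝ)..1, (starRingEnd ℂ) (Φ₁ x) * deriv Φ₁ x) ≠ 0 := by
  have hcC : ∀ x, HasDerivAt (fun x => (c x : ℂ)) (c' x : ℂ) x := fun x => (hc x).ofReal_comp
  have hsC : ∀ x, HasDerivAt (fun x => (s x : ℂ)) (s' x : ℂ) x := fun x => (hs x).ofReal_comp
  have hc'C : ∀ x, HasDerivAt (fun x => (c' x : ℂ)) ((q x : ℂ) * (c x : ℂ)) x := fun x => by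
    simpa using (hc' x).ofReal_comp
  have hs'C : ∀ x, HasDerivAt (fun x => (s' x : ℂ)) ((q x : ℂ) * (s x : ℂ)) x := fun x => by
    simpa using (hs' x).ofReal_comp
  have hWC : ∀ x, (c x : ℂ) * s' x - c' x * s x = 1 := by
    intro x
    have := dp_wronskian_s7 (fun x => (q x : ℂ)) _ _ _ _ hcC hc'C hsC hs'C x
    simpa [c0, cp0, s0, sp0] using this
  have hW : ∀ x, c x * s' x - c' x * s x = 1 := fun x => by exact_mod_cast hWC x
  -- representation of solutions
  have hrep : ∀ (f f' : ℝ → ℂ), (∀ x, HasDerivAt f (f' x) x) →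
      (∀ x, HasDerivAt f' ((q x : ℂ) * f x) x) → ∀ x, f x = f 0 * c x + f' 0 * s x := by
    intro f f' hf hf' x
    have h1 := dp_wronskian_s7 (fun x => (q x : ℂ)) _ _ _ _ hf hf' hsC hs'C x
    have h2 := dp_wronskian_s7 (fun x => (q x : ℂ)) _ _ _ _ hf hf' hcC hc'C x
    simp only [c0, cp0, s0, sp0] at h1 h2
    push_cast at h1 h2
    linear_combination (c x : ℂ) * h1 - (s x : ℂ) * h2 - f x * hWC x
  set a := c (1/2) with ha
  set b := s (1/2) with hb
  have hs'h : s' (1/2) = -a := by linarith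
  have hWh := hW (1/2)
  rw [hs'h, ← ha, ← hb] at hWh
  have hb0 : b ≠ 0 := by
    intro h
    rw [h] at hWh
    nlinarith [sq_nonneg a]
  -- pseudo-periodic solution
  have hper : ∀ (α β : ℂ), α * a + β * b = Complex.I * α → ∀ x,
      α * c (x + 1/2) + β * s (x + 1/2) = Complex.I * (α * c x + β * s x) := by
    intro α β h x
    have h1 : ∀ x, HasDerivAt (fun x : ℝ => α * c (x + 1/2) + β * s (x + 1/2))
        (α * c' (x + 1/2) + β * s' (x + 1/2)) x := by
      intro x
      exact (((hcC (x+1/2)).comp_add_const x (1/2)).const_mul α).add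
        (((hsC (x+1/2)).comp_add_const x (1/2)).const_mul β)
    have h2 : ∀ x, HasDerivAt (fun x : ℝ => α * c' (x + 1/2) + β * s' (x + 1/2))
        ((q x : ℂ) * (α * c (x + 1/2) + β * s (x + 1/2))) x := by
      intro x
      have := (((hc'C (x+1/2)).comp_add_const x (1/2)).const_mul α).add
        (((hs'C (x+1/2)).comp_add_const x (1/2)).const_mul β)
      rw [hqp] at this
      refine this.congr_deriv ?_
      ring
    have := hrep _ _ h1 h2 x
    rw [this]
    simp only [zero_add]
    rw [← ha, ← hb, hs'h, h]
    have e : α * c' (1/2) + β * ((-a : ℝ) : ℂ) = Complex.I * β := by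
      have hbC : (b : ℂ) ≠ 0 := by exact_mod_cast hb0
      apply mul_right_cancel₀ hbC
      have hWhC : (a : ℂ) * (-a) - c' (1/2) * b = 1 := by exact_mod_cast hWh
      push_cast
      linear_combination (-α) * hWhC - (a + Complex.I) * h - α * Complex.I_mul_I
    rw [e]; ring
  let Φ : ℝ → ℂ := fun x => b * c x + (Complex.I - a) * s x
  let Φ' : ℝ → ℂ := fun x => b * c' x + (Complex.I - a) * s' x
  have hΦ : ∀ x, HasDerivAt Φ (Φ' x) x := fun x =>
    ((hcC x).const_mul _).add ((hsC x).const_mul _)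
  have hΦ' : ∀ x, HasDerivAt Φ' ((q x : ℂ) * Φ x) x := fun x => by
    refine (((hc'C x).const_mul _).add ((hs'C x).const_mul _)).congr_deriv ?_
    simp only [Φ]; ring
  have hΦc : Continuous Φ := continuous_iff_continuousAt.2 fun x => (hΦ x).continuousAt
  have hΦ'c : Continuous Φ' := continuous_iff_continuousAt.2 fun x => (hΦ' x).continuousAt
  have hΦp : ∀ x, Φ (x + 1/2) = Complex.I * Φ x := by
    intro x
    exact hper _ _ (by ring) x
  have hΦ0 : Φ 0 = b := by simp [Φ, c0, s0]
  set N := ∫ x in (0:ℝ)..1, ‖Φ x‖ ^ 2 with hN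
  have hNpos : 0 < N := by
    apply intervalIntegral.integral_pos one_pos (by fun_prop) (fun x _ => by positivity)
    refine ⟨0, by simp, ?_⟩
    rw [hΦ0]
    have : (b:ℂ) ≠ 0 := by exact_mod_cast hb0
    positivity
  obtain ⟨r, hr, hrN⟩ : ∃ r : ℝ, 0 < r ∧ r ^ 2 * N = 1 := by
    refine ⟨(Real.sqrt N)⁻¹, by positivity, ?_⟩
    rw [inv_pow, Real.sq_sqrt hNpos.le]
    field_simp
  have hrC : (r : ℂ) ≠ 0 := by exact_mod_cast hr.ne'
  have hd : deriv (fun x => (r : ℂ) * Φ x) = fun x => (r : ℂ) * Φ' x := by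
    funext x; exact ((hΦ x).const_mul _).deriv
  have hdd : deriv (fun x => (r : ℂ) * Φ' x) = fun x => (r : ℂ) * ((q x : ℂ) * Φ x) := by
    funext x; exact ((hΦ' x).const_mul _).deriv
  refine ⟨fun x => (r : ℂ) * Φ x, ?_, ?_, ?_, ?_, ?_, ?_, ?_⟩
  · have h2 : (2 : WithTop ℕ∞) = 1 + 1 := by norm_num
    rw [h2, contDiff_succ_iff_deriv]
    refine ⟨fun x => ((hΦ x).const_mul _).differentiableAt, by simp, ?_⟩
    rw [hd, contDiff_one_iff_deriv]
    refine ⟨fun x => ((hΦ' x).const_mul _).differentiableAt, ?_⟩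
    rw [hdd]
    fun_prop
  · intro h
    have := congrFun h 0
    simp [hΦ0, hr.ne', hb0] at this
  · intro x
    rw [hd, hdd]; ring
  · intro x
    simp only [hΦp]; ring
  · intro Ψ hΨ hode hp
    have h2 : (2 : WithTop ℕ∞) = 1 + 1 := by norm_num
    rw [h2, contDiff_succ_iff_deriv] at hΨ
    have hΨ2 := hΨ.2.2
    rw [contDiff_one_iff_deriv] at hΨ2
    have r1 := hrep Ψ (deriv Ψ) (fun x => (hΨ.1 x).hasDerivAt)
      (fun x => by rw [← hode]; exact (hΨ2.1 x).hasDerivAt)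
    have hbC : (b : ℂ) ≠ 0 := by exact_mod_cast hb0
    refine ⟨Ψ 0 / (b * r), fun x => ?_⟩
    have h3 := hp 0
    rw [zero_add, r1 (1/2)] at h3
    rw [← ha, ← hb] at h3
    rw [r1 x]
    simp only [Φ]
    field_simp
    linear_combination (s x : ℂ) * h3
  · have : ∀ x, ‖(r : ℂ) * Φ x‖ ^ 2 = r ^ 2 * ‖Φ x‖ ^ 2 := by
      intro x
      rw [norm_mul, mul_pow, Complex.norm_real, Real.norm_eq_abs, sq_abs]
    simp only [this, intervalIntegral.integral_const_mul]
    exact hrN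
  · rw [hd]
    apply mul_ne_zero (by simp)
    intro h
    have h1 := congrArg Complex.im h
    have h2 : (∫ x in (0:ℝ)..1, (starRingEnd ℂ) ((r : ℂ) * Φ x) * ((r : ℂ) * Φ' x)).im
        = ∫ x in (0:ℝ)..1, ((starRingEnd ℂ) ((r : ℂ) * Φ x) * ((r : ℂ) * Φ' x)).im := by
      have := Complex.imCLM.intervalIntegral_comp_comm (μ := volume) (a := 0) (b := 1)
        (f := fun x => (starRingEnd ℂ) ((r : ℂ) * Φ x) * ((r : ℂ) * Φ' x))
        (Continuous.intervalIntegrable (by fun_prop) _ _)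
      simpa using this.symm
    have h3 : ∀ x, ((starRingEnd ℂ) ((r : ℂ) * Φ x) * ((r : ℂ) * Φ' x)).im = r ^ 2 * b := by
      intro x
      simp [Φ, Φ']
      linear_combination r ^ 2 * b * hW x
    rw [h2] at h1
    simp only [h3] at h1
    simp [hr.ne', hb0] at h1

noncomputable def dpT (ω : ℝ) (W : ℝ →ᵇ ℝ) : (ℝ →ᵇ ℝ) →L[ℝ] (ℝ →ᵇ ℝ) :=
  1 - dpK ω ∘L dpMul W

/-- (rescaled) trace of the monodromy matrix, when `cos (ω/2) = 0`. -/
noncomputable def dpTr (ω : ℝ) (W : ℝ →ᵇ ℝ) : ℝ :=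
  BoundedContinuousFunction.evalCLM ℝ (1/2 : ℝ)
    (Ring.inverse (dpT ω W) (dpC ω * dpH)
      + Real.sin (ω * (1/2)) •
        dpJ (dpS ω * (W * Ring.inverse (dpT ω W) (ω⁻¹ • dpS ω * dpH))))

theorem dpT_fix (ω : ℝ) (W g0 : ℝ →ᵇ ℝ) (h : IsUnit (dpT ω W)) :
    Ring.inverse (dpT ω W) g0 = g0 + dpK ω (W * Ring.inverse (dpT ω W) g0) := by
  have h1 : dpT ω W * Ring.inverse (dpT ω W) = 1 := Ring.mul_inverse_cancel _ h
  have h2 := DFunLike.congr_fun h1 g0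
  rw [mul_apply_eq_comp] at h2
  simp only [one_apply_eq_self] at h2
  set g := Ring.inverse (dpT ω W) g0
  have h3 : g - dpK ω (W * g) = g0 := by
    simpa [dpT] using h2
  rw [← h3]; abel

theorem dpT_zero (ω : ℝ) : dpT ω 0 = 1 := by
  ext1 f
  simp [dpT]

theorem dp_core (ω : ℝ) (hω : ω ≠ 0) (hcos : Real.cos (ω * (1/2)) = 0)
    (V : ℝ → ℝ) (hV : Continuous V) (hVhalf : ∀ x, V (x + 1/2) = V x) :
    ∃ ε₀ > (0:ℝ), ∃ m : ℝ → ℝ, ContinuousOn m (Set.Ioo (-ε₀) ε₀) ∧ m 0 = 0 ∧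
      ∀ ε ∈ Set.Ioo (-ε₀) ε₀, ∃ c c' s s' : ℝ → ℝ,
        (∀ x, HasDerivAt c (c' x) x) ∧
        (∀ x, HasDerivAt c' ((ε * V x - m ε - ω ^ 2) * c x) x) ∧
        (∀ x, HasDerivAt s (s' x) x) ∧
        (∀ x, HasDerivAt s' ((ε * V x - m ε - ω ^ 2) * s x) x) ∧
        c 0 = 1 ∧ c' 0 = 0 ∧ s 0 = 0 ∧ s' 0 = 1 ∧ c (1/2) + s' (1/2) = 0 := by
  obtain ⟨M, hM⟩ : ∃ M, ∀ x, ‖V x‖ ≤ M := by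
    obtain ⟨M, hM⟩ := (isCompact_Icc (a := (0:ℝ)) (b := 1/2)).exists_bound_of_continuousOn
      hV.continuousOn
    refine ⟨M, fun x => ?_⟩
    obtain ⟨y, hy, hxy⟩ := Function.Periodic.exists_mem_Ico₀ (f := V) (c := 1/2) hVhalf
      (by norm_num) x
    rw [hxy]
    exact hM y ⟨hy.1, hy.2.le⟩
  let Vb : ℝ →ᵇ ℝ := BoundedContinuousFunction.ofNormedAddCommGroup V hV M hM
  let W : ℝ × ℝ → (ℝ →ᵇ ℝ) := fun p => p.1 • Vb - p.2 • 1
  have hW0 : W (0, 0) = 0 := by simp [W]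
  have hWs : ContDiff ℝ 1 W := by fun_prop
  have hTs : ContDiff ℝ 1 (fun p => dpT ω (W p)) := by
    unfold dpT
    refine contDiff_const.sub (contDiff_const.clm_comp ?_)
    exact (ContinuousLinearMap.contDiff (E := ℝ →ᵇ ℝ) (F := (ℝ →ᵇ ℝ) →L[ℝ] (ℝ →ᵇ ℝ)) dpMul).comp hWs
  have hIs : ContDiffAt ℝ 1 (fun p => Ring.inverse (dpT ω (W p))) (0, 0) := by
    have h1 : ContDiffAt ℝ 1 Ring.inverse (dpT ω (W (0, 0))) := by
      rw [hW0, dpT_zero]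
      exact dp_inv_contDiffAt (R := (ℝ →ᵇ ℝ) →L[ℝ] (ℝ →ᵇ ℝ))
    exact h1.comp (0, 0) hTs.contDiffAt
  have hunit : ∀ᶠ p in 𝓝 ((0, 0) : ℝ × ℝ), IsUnit (dpT ω (W p)) := by
    have : ContinuousAt (fun p => dpT ω (W p)) (0, 0) := hTs.continuous.continuousAt
    apply this.eventually
    simp only [hW0, dpT_zero]
    exact dp_unit_nhds (R := (ℝ →ᵇ ℝ) →L[ℝ] (ℝ →ᵇ ℝ))
  have hF : ContDiffAt ℝ 1 (fun p => dpTr ω (W p)) (0, 0) := by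
    unfold dpTr
    refine (ContinuousLinearMap.contDiff _).contDiffAt.comp (0, 0) ?_
    refine (hIs.clm_apply contDiffAt_const).add (ContDiffAt.const_smul _ ?_)
    refine (ContinuousLinearMap.contDiff _).contDiffAt.comp (0, 0) ?_
    exact contDiffAt_const.mul (hWs.contDiffAt.mul (hIs.clm_apply contDiffAt_const))
  have hF0 : dpTr ω (W (0, 0)) = 0 := by
    rw [hW0, dpTr, dpT_zero]
    have : (dpC ω * dpH) (1/2 : ℝ) = 0 := by
      change Real.cos (ω * (1/2)) * _ = 0
      rw [hcos, zero_mul]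
    simpa using this
  have hsin : Real.sin (ω * (1/2)) ≠ 0 := by
    intro h
    have := Real.sin_sq_add_cos_sq (ω * (1/2))
    rw [h, hcos] at this
    norm_num at this
  have hder : HasDerivAt (fun t : ℝ => dpTr ω (W (0, t)))
      (-(Real.sin (ω * (1/2)) * ω⁻¹ * ((Real.cosh (1/2))⁻¹ * (1/2)))) 0 := by
    have hW1 : HasDerivAt (fun t : ℝ => W (0, t)) (-1) 0 := by
      have := ((hasDerivAt_id (0:ℝ)).smul_const (1 : ℝ →ᵇ ℝ)).const_sub ((0:ℝ) • Vb)
      simpa [W] using this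
    have hW00 : W (0, 0) = 0 := hW0
    have hT1 : HasDerivAt (fun t : ℝ => dpT ω (W (0, t))) (dpK ω) 0 := by
      have h0 : HasFDerivAt (E := ℝ →ᵇ ℝ) (F := (ℝ →ᵇ ℝ) →L[ℝ] (ℝ →ᵇ ℝ)) dpMul dpMul (W (0, 0)) :=
        ContinuousLinearMap.hasFDerivAt (E := ℝ →ᵇ ℝ) (F := (ℝ →ᵇ ℝ) →L[ℝ] (ℝ →ᵇ ℝ)) dpMul
      have h1 := HasFDerivAt.comp_hasDerivAt (F := ℝ →ᵇ ℝ) (E := (ℝ →ᵇ ℝ) →L[ℝ] (ℝ →ᵇ ℝ)) (0:ℝ) h0 hW1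
      have h2 := HasDerivAt.const_sub (𝕜 := ℝ) (F := (ℝ →ᵇ ℝ) →L[ℝ] (ℝ →ᵇ ℝ)) (x := (0:ℝ))
        (hf := (hasDerivAt_const (0:ℝ) (dpK ω)).clm_comp h1) (c :=
        (1 : (ℝ →ᵇ ℝ) →L[ℝ] (ℝ →ᵇ ℝ)))
      refine h2.congr_deriv ?_
      ext1 f
      simp
    have hI1 : HasDerivAt (fun t : ℝ => Ring.inverse (dpT ω (W (0, t)))) (-dpK ω) 0 := by
      have h1 := dp_inv_hasFDerivAt (R := (ℝ →ᵇ ℝ) →L[ℝ] (ℝ →ᵇ ℝ))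
      rw [← dpT_zero ω, ← hW0] at h1
      have h2 := HasFDerivAt.comp_hasDerivAt (F := (ℝ →ᵇ ℝ) →L[ℝ] (ℝ →ᵇ ℝ)) (E := (ℝ →ᵇ ℝ) →L[ℝ] (ℝ →ᵇ ℝ)) (0:ℝ) h1 hT1
      refine h2.congr_deriv ?_
      simp
    have hIc := hI1.clm_apply (hasDerivAt_const (0:ℝ) (dpC ω * dpH))
    have hIs' := hI1.clm_apply (hasDerivAt_const (0:ℝ) (ω⁻¹ • dpS ω * dpH))
    have hJ := dpJ.hasFDerivAt.comp_hasDerivAt (0:ℝ) ((hW1.mul hIs').const_mul (dpS ω))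
    have hall := (BoundedContinuousFunction.evalCLM ℝ (1/2 : ℝ)).hasFDerivAt.comp_hasDerivAt (0:ℝ)
      (hIc.add (hJ.const_smul (Real.sin (ω * (1/2)))))
    refine hall.congr_deriv ?_
    have eI : Ring.inverse (dpT ω (W (0, 0))) = 1 := by rw [hW0, dpT_zero]; simp
    rw [eI, hW0]
    have key : dpJ (dpC ω * (dpC ω * dpH)) (1/2) + dpJ (dpS ω * (dpS ω * dpH)) (1/2)
        = (Real.cosh (1/2))⁻¹ * (1/2) := by
      have h1 : dpJ (dpC ω * (dpC ω * dpH)) (1/2) + dpJ (dpS ω * (dpS ω * dpH)) (1/2)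
        = dpJ (dpC ω * (dpC ω * dpH) + dpS ω * (dpS ω * dpH)) (1/2) := by
        rw [map_add]; rfl
      have h2 : dpC ω * (dpC ω * dpH) + dpS ω * (dpS ω * dpH) = dpH := by
        ext x
        change Real.cos (ω * x) * (Real.cos (ω * x) * (Real.cosh x)⁻¹) +
          Real.sin (ω * x) * (Real.sin (ω * x) * (Real.cosh x)⁻¹) = (Real.cosh x)⁻¹
        linear_combination (Real.cosh x)⁻¹ * Real.sin_sq_add_cos_sq (ω * x)
      rw [h1, h2, dpJ_apply]
      have h3 : ∀ y, Real.cosh y * dpH y = 1 := fun y =>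
        mul_inv_cancel₀ (Real.cosh_pos y).ne'
      simp [h3]
    have kK : dpK ω (dpC ω * dpH) (1/2) =
        ω⁻¹ * (Real.sin (ω * (1/2)) * dpJ (dpC ω * (dpC ω * dpH)) (1/2)) := by
      rw [dpK_apply]
      change ω⁻¹ * (Real.sin (ω * (1/2)) * dpJ (dpC ω * (dpC ω * dpH)) (1/2)
        - Real.cos (ω * (1/2)) * _) = _
      rw [hcos]; ring
    have kJ : dpJ (dpS ω * (-1 * (ω⁻¹ • dpS ω * dpH))) (1/2)
        = - (ω⁻¹ * dpJ (dpS ω * (dpS ω * dpH)) (1/2)) := by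
      have : dpS ω * (-1 * (ω⁻¹ • dpS ω * dpH)) = (-ω⁻¹) • (dpS ω * (dpS ω * dpH)) := by
        ext x
        change Real.sin (ω * x) * (-1 * (ω⁻¹ * Real.sin (ω * x) * (Real.cosh x)⁻¹)) =
          -ω⁻¹ * (Real.sin (ω * x) * (Real.sin (ω * x) * (Real.cosh x)⁻¹))
        ring
      rw [this, map_smul, BoundedContinuousFunction.smul_apply, smul_eq_mul, neg_mul]
    simp only [map_zero, add_zero, zero_mul, one_apply_eq_self]
    change -(dpK ω (dpC ω * dpH) (1/2)) + Real.sin (ω * (1/2)) *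
      dpJ (dpS ω * (-1 * (ω⁻¹ • dpS ω * dpH))) (1/2) = _
    rw [kK, kJ, ← key]
    ring
  obtain ⟨ε₀, hε₀, m, hmc, hm0, hm⟩ := dp_ift (fun p => dpTr ω (W p)) hF _ (by
    have := (Real.cosh_pos (1/2)).ne'
    simp only [neg_ne_zero]
    positivity) hder hF0 _ hunit
  refine ⟨ε₀, hε₀, m, hmc, hm0, fun ε hε => ?_⟩
  obtain ⟨htr, hu⟩ := hm ε hε
  have hWx : ∀ x, W (ε, m ε) x = ε * V x - m ε := by
    intro x
    change ε * V x - m ε * 1 = _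
    ring
  obtain ⟨c, c', hc, hc', c0, cp0, hcg, -⟩ := dp_solve ω hω (W (ε, m ε))
    (Ring.inverse (dpT ω (W (ε, m ε))) (dpC ω * dpH)) 1 0 (by
      simpa using dpT_fix ω (W (ε, m ε)) (dpC ω * dpH) hu)
  obtain ⟨s, s', hs, hs', s0, sp0, -, hsg⟩ := dp_solve ω hω (W (ε, m ε))
    (Ring.inverse (dpT ω (W (ε, m ε))) (ω⁻¹ • dpS ω * dpH)) 0 ω⁻¹ (by
      simpa using dpT_fix ω (W (ε, m ε)) (ω⁻¹ • dpS ω * dpH) hu)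
  simp only [hWx] at hc' hs'
  refine ⟨c, c', s, s', hc, hc', hs, hs', c0, by simpa using cp0, s0, ?_, ?_⟩
  · rw [sp0, mul_inv_cancel₀ hω]
  · rw [hcg, hsg, hcos]
    have h : Ring.inverse (dpT ω (W (ε, m ε))) (dpC ω * dpH) (1/2) +
      Real.sin (ω * (1/2)) * dpJ (dpS ω * (W (ε, m ε) *
        Ring.inverse (dpT ω (W (ε, m ε))) (ω⁻¹ • dpS ω * dpH))) (1/2) = 0 := htr
    linear_combination Real.cosh (1/2) * h

/-- Dirac points for small coupling. -/
theorem dirac_points_small_coupling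
    (V : ℝ → ℝ) (hV : ContDiff ℝ (⊤ : ℕ∞) V) (hVeven : ∀ x, V (-x) = V x)
    (hVhalf : ∀ x, V (x + 1/2) = V x)
    (n : ℕ) (hn : 1 ≤ n) :
    ∃ ε₀ > (0:ℝ), ∃ Estar : ℝ → ℝ,
      ContinuousOn Estar (Set.Ioo (-ε₀) ε₀) ∧
      Estar 0 = Real.pi ^ 2 * (2 * (n : ℝ) + 1) ^ 2 ∧
      ∀ ε ∈ Set.Ioo (-ε₀) ε₀,
        ∃ Φ₁ : ℝ → ℂ, ContDiff ℝ 2 Φ₁ ∧ Φ₁ ≠ 0 ∧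
          (∀ x, -(deriv (deriv Φ₁) x) + (ε : ℂ) * (V x : ℂ) * Φ₁ x = (Estar ε : ℂ) * Φ₁ x) ∧
          (∀ x, Φ₁ (x + 1/2) = Complex.I * Φ₁ x) ∧
          (∀ Φ : ℝ → ℂ, ContDiff ℝ 2 Φ →
            (∀ x, -(deriv (deriv Φ) x) + (ε : ℂ) * (V x : ℂ) * Φ x = (Estar ε : ℂ) * Φ x) →
            (∀ x, Φ (x + 1/2) = Complex.I * Φ x) → ∃ c : ℂ, ∀ x, Φ x = c * Φ₁ x) ∧
          (∫ x in (0:ℝ)..1, ‖Φ₁ x‖ ^ 2) = 1 ∧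
          2 * Complex.I * (∫ x in (0:ℝ)..1, (starRingEnd ℂ) (Φ₁ x) * deriv Φ₁ x) ≠ 0 := by
  have hω : Real.pi * (2 * (n : ℝ) + 1) ≠ 0 := by positivity
  have hcos : Real.cos (Real.pi * (2 * (n : ℝ) + 1) * (1/2)) = 0 := by
    rw [Real.cos_eq_zero_iff]
    exact ⟨n, by push_cast; ring⟩
  obtain ⟨ε₀, hε₀, m, hmc, hm0, hm⟩ := dp_core _ hω hcos V hV.continuous hVhalf
  set ω := Real.pi * (2 * (n : ℝ) + 1) with hωdef
  refine ⟨ε₀, hε₀, fun ε => m ε + ω ^ 2, hmc.add continuousOn_const, ?_, ?_⟩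
  · simp only [hm0, hωdef]; ring
  intro ε hε
  obtain ⟨c, c', s, s', hc, hc', hs, hs', c0, cp0, s0, sp0, htr⟩ := hm ε hε
  have hVc := hV.continuous
  have hode : ∀ (x : ℝ) (a b : ℂ), (-a + (ε : ℂ) * (V x : ℂ) * b = ((m ε + ω ^ 2 : ℝ) : ℂ) * b) ↔
      a = ((ε * V x - m ε - ω ^ 2 : ℝ) : ℂ) * b := by
    intro x a b
    push_cast
    constructor <;> intro h <;> linear_combination -h
  simp only [hode]
  exact dp_endgame (fun x => ε * V x - m ε - ω ^ 2) (by fun_prop)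
    (fun x => by simp only [hVhalf]) c c' s s' hc hc' hs hs' c0 cp0 s0 sp0 htr
end

section
/- Dirac points for generic coupling: discreteness of the exceptional set. Let V be an even-index cosine potential. Then there exist ε₀ > 0, constants C̄₀, C̄₁ > 0 depending only on V, and a set 𝒞 ⊂ ℝ ∖ (−ε₀, ε₀) having no accumulation point in ℝ, such that for every real ε ∉ 𝒞 there exist E ∈ ℝ with |E| ≤ C̄₀|ε| + C̄₁ and a twice continuously differentiable Φ₁ : ℝ → ℂ, not identically zero, satisfying: (i) −Φ₁″(x) + εV(x)Φ₁(x) = EΦ₁(x) for all x and Φ₁(x + 1/2) = iΦ₁(x) for all x; (ii) every twice continuously differentiable solution Φ of −Φ″ + εVΦ = EΦ with Φ(x + 1/2) = iΦ(x) for all x is a complex scalar multiple of Φ₁; (iii) after normalizing ∫₀¹ |Φ₁|² = 1, λ♯ := 2i ∫₀¹ conj(Φ₁(x)) Φ₁′(x) dx ≠ 0. -/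
open MeasureTheory Filter

/-- Picard iterates of the linear system `w' = A w`. -/
noncomputable def picIter {P F : Type*} [NormedAddCommGroup F] [NormedSpace ℝ F]
    (A : P → ℝ → F →L[ℝ] F) (w₀ : F) : ℕ → P → ℝ → F
  | 0 => fun _ _ => w₀
  | n + 1 => fun p x => ∫ s in (0:ℝ)..x, A p s (picIter A w₀ n p s)

section Lin
variable {P F : Type*} [TopologicalSpace P] [NormedAddCommGroup F] [NormedSpace ℝ F]
  [CompleteSpace F] (A : P → ℝ → F →L[ℝ] F) (w₀ : F)

lemma picIter_cont (hA : Continuous (Function.uncurry A)) (n : ℕ) :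
    Continuous (fun z : P × ℝ => picIter A w₀ n z.1 z.2) := by
  induction n with
  | zero => exact continuous_const
  | succ n ih =>
    refine intervalIntegral.continuous_parametric_intervalIntegral_of_continuous
      (X := P × ℝ) (f := fun z s => A z.1 s (picIter A w₀ n z.1 s)) (s := fun z => z.2) ?_
      continuous_snd
    have h1 : Continuous (fun z : (P × ℝ) × ℝ => A z.1.1 z.2) :=
      hA.comp ((continuous_fst.comp continuous_fst).prodMk continuous_snd)
    have h2 : Continuous (fun z : (P × ℝ) × ℝ => picIter A w₀ n z.1.1 z.2) :=
      ih.comp ((continuous_fst.comp continuous_fst).prodMk continuous_snd)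
    exact h1.clm_apply h2

lemma picIter_bound {c : ℝ} (hc0 : 0 ≤ c) (hc : ∀ p t, ‖A p t‖ ≤ c)
    (n : ℕ) (p : P) (x : ℝ) :
    ‖picIter A w₀ n p x‖ ≤ ‖w₀‖ * ((c * |x|) ^ n / n.factorial) := by
  induction n generalizing x with
  | zero => simp [picIter]
  | succ n ih =>
    have e : ∀ s, ‖A p s (picIter A w₀ n p s)‖ ≤ ‖w₀‖ * c ^ (n+1) / n.factorial * |s - 0| ^ n := by
      intro s
      calc _ ≤ ‖A p s‖ * ‖picIter A w₀ n p s‖ := ContinuousLinearMap.le_opNorm _ _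
        _ ≤ c * (‖w₀‖ * ((c * |s|) ^ n / n.factorial)) :=
          mul_le_mul (hc p s) (ih s) (norm_nonneg _) hc0
        _ = _ := by rw [sub_zero, mul_pow]; ring
    calc ‖picIter A w₀ (n+1) p x‖ ≤ ∫ s in Set.uIoc 0 x, ‖A p s (picIter A w₀ n p s)‖ :=
          intervalIntegral.norm_integral_le_integral_norm_uIoc
      _ ≤ ∫ s in Set.uIoc 0 x, ‖w₀‖ * c ^ (n+1) / n.factorial * |s - 0| ^ n := by
          refine integral_mono_of_nonneg (Eventually.of_forall fun s => norm_nonneg _) ?_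
            (Eventually.of_forall e)
          have : Continuous (fun s : ℝ => ‖w₀‖ * c ^ (n+1) / n.factorial * |s - 0| ^ n) := by
            fun_prop
          exact this.integrableOn_uIoc
      _ = _ := by
          rw [integral_const_mul, integral_pow_abs_sub_uIoc, sub_zero, Nat.factorial_succ, mul_pow]
          push_cast
          field_simp

/-- Existence of solutions of bounded linear systems, depending continuously on a parameter. -/
lemma lin_exists (hA : Continuous (Function.uncurry A)) {c : ℝ} (hc0 : 0 ≤ c)
    (hc : ∀ p t, ‖A p t‖ ≤ c) :
    ∃ w : P → ℝ → F, Continuous (fun z : P × ℝ => w z.1 z.2) ∧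
      (∀ p x, HasDerivAt (w p) (A p x (w p x)) x) ∧ ∀ p, w p 0 = w₀ := by
  have hb := picIter_bound A w₀ hc0 hc
  have hcont := picIter_cont A w₀ hA
  have hs : ∀ R : ℝ, Summable (fun n : ℕ => ‖w₀‖ * ((c * R) ^ n / n.factorial)) := fun R =>
    (Real.summable_pow_div_factorial _).mul_left _
  have hb' : ∀ R : ℝ, ∀ n p x, x ∈ Set.Ioo (-R) R →
      ‖picIter A w₀ n p x‖ ≤ ‖w₀‖ * ((c * R) ^ n / n.factorial) := by
    intro R n p x hx
    refine (hb n p x).trans ?_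
    have : |x| ≤ R := (abs_lt.2 hx).le
    gcongr
  have hsum : ∀ p x, Summable (fun n => picIter A w₀ n p x) := fun p x =>
    Summable.of_norm_bounded (hs |x|) (fun n => hb n p x)
  have hx1 : ∀ x : ℝ, x ∈ Set.Ioo (-(|x|+1)) (|x|+1) := fun x => abs_lt.1 (by linarith)
  refine ⟨fun p x => ∑' n, picIter A w₀ n p x, ?_, ?_, ?_⟩
  · rw [continuous_iff_continuousAt]
    rintro ⟨p, x⟩
    have : ContinuousOn (fun z : P × ℝ => ∑' n, picIter A w₀ n z.1 z.2)
        (Set.univ ×ˢ Set.Ioo (-(|x|+1)) (|x|+1)) :=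
      continuousOn_tsum (fun n => (hcont n).continuousOn) (hs (|x|+1))
        (fun n z hz => hb' _ n z.1 z.2 hz.2)
    exact this.continuousAt ((isOpen_univ.prod isOpen_Ioo).mem_nhds ⟨trivial, hx1 x⟩)
  · intro p x
    have e : (fun x => ∑' n, picIter A w₀ n p x) = fun x => w₀ + ∑' n, picIter A w₀ (n+1) p x := by
      ext x
      rw [(hsum p x).tsum_eq_zero_add]; rfl
    have hd : HasDerivAt (fun x => ∑' n, picIter A w₀ (n+1) p x)
        (∑' n, A p x (picIter A w₀ n p x)) x := by
      refine hasDerivAt_tsum_of_isPreconnected (u := fun n : ℕ => c * (‖w₀‖ * ((c * (|x|+1)) ^ n / n.factorial)))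
        (g' := fun n x => A p x (picIter A w₀ n p x))
        (t := Set.Ioo (-(|x|+1)) (|x|+1)) ((hs _).mul_left c) isOpen_Ioo isPreconnected_Ioo
        ?_ ?_ (hx1 x) ?_ (hx1 x)
      · intro n y _
        have : Continuous (fun s => A p s (picIter A w₀ n p s)) :=
          (hA.comp (continuous_const.prodMk continuous_id)).clm_apply
            ((hcont n).comp (continuous_const.prodMk continuous_id))
        exact (this.integral_hasStrictDerivAt 0 y).hasDerivAt
      · intro n y hy
        exact (ContinuousLinearMap.le_opNorm _ _).trans
          (mul_le_mul (hc p y) (hb' _ n p y hy) (norm_nonneg _) hc0)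
      · exact (summable_nat_add_iff 1).2 (hsum p x)
    rw [← ContinuousLinearMap.map_tsum _ (hsum p x)] at hd
    have := hd.const_add w₀
    rw [← e] at this
    exact this
  · intro p
    show ∑' n, picIter A w₀ n p 0 = w₀
    rw [(hsum p 0).tsum_eq_zero_add]
    simp [picIter]

end Lin

/-- Existence of the even-type fundamental solution with continuous dependence. -/
lemma hill_exists {P : Type*} [TopologicalSpace P] (q : P → ℝ → ℝ)
    (hq : Continuous (Function.uncurry q)) {Q : ℝ} (hQ : ∀ p t, |q p t| ≤ Q) :
    ∃ u u' : P → ℝ → ℝ, Continuous (fun z : P × ℝ => u z.1 z.2) ∧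
      (∀ p x, HasDerivAt (u p) (u' p x) x) ∧ (∀ p x, HasDerivAt (u' p) (q p x * u p x) x) ∧
      (∀ p, u p 0 = 1) ∧ ∀ p, u' p 0 = 0 := by
  let A : P → ℝ → (ℝ × ℝ) →L[ℝ] (ℝ × ℝ) := fun p t =>
    (ContinuousLinearMap.inl ℝ ℝ ℝ).comp (ContinuousLinearMap.snd ℝ ℝ ℝ) +
      q p t • (ContinuousLinearMap.inr ℝ ℝ ℝ).comp (ContinuousLinearMap.fst ℝ ℝ ℝ)
  have hA : Continuous (Function.uncurry A) := by
    exact continuous_const.add (hq.smul continuous_const)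
  have hc : ∀ p t, ‖A p t‖ ≤ max 1 Q := by
    intro p t
    refine ContinuousLinearMap.opNorm_le_bound _ (by positivity) ?_
    rintro ⟨a, b⟩
    have ha : |a| ≤ ‖(a, b)‖ := norm_fst_le (a, b)
    have hb : |b| ≤ ‖(a, b)‖ := norm_snd_le (a, b)
    have hAab : A p t (a, b) = (b, q p t * a) := by simp [A]
    rw [hAab]
    rw [Prod.norm_mk, Real.norm_eq_abs, Real.norm_eq_abs, abs_mul]
    refine max_le ?_ ?_
    · calc |b| = 1 * |b| := (one_mul _).symm
        _ ≤ _ := mul_le_mul (le_max_left _ _) hb (abs_nonneg _) (by positivity)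
    · exact mul_le_mul ((hQ p t).trans (le_max_right _ _)) ha (abs_nonneg _) (by positivity)
  obtain ⟨w, hw, hd, h0⟩ := lin_exists A ((1:ℝ), (0:ℝ)) hA (by positivity) hc
  refine ⟨fun p x => (w p x).1, fun p x => (w p x).2, continuous_fst.comp hw, ?_, ?_, ?_, ?_⟩
  · intro p x
    have hA1 : (A p x (w p x)).1 = (w p x).2 := by simp [A]
    show HasDerivAt (fun x => (w p x).1) (w p x).2 x
    rw [← hA1]
    exact (hasFDerivAt_fst (𝕜 := ℝ) (p := w p x)).comp_hasDerivAt x (hd p x)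
  · intro p x
    have hA2 : (A p x (w p x)).2 = q p x * (w p x).1 := by simp [A]
    show HasDerivAt (fun x => (w p x).2) (q p x * (w p x).1) x
    rw [← hA2]
    exact (hasFDerivAt_snd (𝕜 := ℝ) (p := w p x)).comp_hasDerivAt x (hd p x)
  · intro p; simp [h0]
  · intro p; simp [h0]

/-- Uniqueness. -/
lemma hill_unique (q : ℝ → ℝ) {Q : ℝ} (hQ : ∀ t, |q t| ≤ Q) (f f' : ℝ → ℝ)
    (hf : ∀ x, HasDerivAt f (f' x) x) (hf' : ∀ x, HasDerivAt f' (q x * f x) x) (x₀ : ℝ)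
    (h0 : f x₀ = 0) (h0' : f' x₀ = 0) (x : ℝ) : f x = 0 ∧ f' x = 0 := by
  have hQ0 : 0 ≤ Q := (abs_nonneg _).trans (hQ 0)
  have := ODE_solution_unique_univ (E := ℝ × ℝ) (v := fun t w => (w.2, q t * w.1))
    (s := fun _ => Set.univ) (K := ⟨max 1 Q, by positivity⟩) (f := fun t => (f t, f' t))
    (g := fun _ => (0, 0)) (t₀ := x₀) ?_ ?_ ?_ (by simp [h0, h0'])
  · have h := congrFun this x
    simpa using h
  · intro t
    refine LipschitzOnWith.of_dist_le_mul ?_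
    rintro ⟨a, b⟩ _ ⟨a', b'⟩ _
    simp only [Prod.dist_eq, Real.dist_eq]
    show max |b - b'| |q t * a - q t * a'| ≤ max 1 Q * max |a - a'| |b - b'|
    rw [← mul_sub, abs_mul]
    refine max_le ?_ ?_
    · calc |b - b'| = 1 * |b - b'| := (one_mul _).symm
        _ ≤ _ := mul_le_mul (le_max_left _ _) (le_max_right _ _) (abs_nonneg _) (by positivity)
    · exact mul_le_mul ((hQ t).trans (le_max_right _ _)) (le_max_left _ _) (abs_nonneg _) (by positivity)
  · intro t; exact ⟨(hf t).prodMk (hf' t), trivial⟩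
  · intro t
    refine ⟨?_, trivial⟩
    have := hasDerivAt_const t ((0:ℝ), (0:ℝ))
    convert this using 1
    simp

/-- The lowest energy with `u(1/2) = 0`. -/
lemma hill_energy (V : ℝ → ℝ) (hV : Continuous V) {B : ℝ} (hB : ∀ x, |V x| ≤ B) (ε : ℝ) :
    ∃ E : ℝ, |E| ≤ |ε| * B + Real.pi ^ 2 ∧ ∃ u u' : ℝ → ℝ, (∀ x, HasDerivAt u (u' x) x) ∧
      (∀ x, HasDerivAt u' ((ε * V x - E) * u x) x) ∧ u 0 = 1 ∧ u' 0 = 0 ∧ u (1/2) = 0 := by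
  have hB0 : 0 ≤ B := (abs_nonneg _).trans (hB 0)
  set M := |ε| * B with hM
  have hM0 : 0 ≤ M := by positivity
  have hεV : ∀ x, |ε * V x| ≤ M := fun x => by
    rw [abs_mul]; exact mul_le_mul_of_nonneg_left (hB x) (abs_nonneg _)
  have hpi : 0 < Real.pi ^ 2 := by positivity
  have hle : -M ≤ M + Real.pi ^ 2 := by linarith
  let P := Set.Icc (-M) (M + Real.pi ^ 2)
  let q : P → ℝ → ℝ := fun p x => ε * V x - p.1
  have hq : Continuous (Function.uncurry q) :=
    (continuous_const.mul (hV.comp continuous_snd)).sub (continuous_subtype_val.comp continuous_fst)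
  have habs : ∀ p : P, |p.1| ≤ M + Real.pi ^ 2 := fun p =>
    abs_le.2 ⟨by linarith [p.2.1], p.2.2⟩
  have hQ : ∀ (p : P) t, |q p t| ≤ M + (M + Real.pi ^ 2) := fun p t =>
    (abs_sub _ _).trans (add_le_add (hεV t) (habs p))
  obtain ⟨u, u', hu, hd, hd', h0, h0'⟩ := hill_exists q hq hQ
  by_contra hcon
  have hne : ∀ p : P, u p (1/2) ≠ 0 := fun p hp =>
    hcon ⟨p.1, habs p, u p, u' p, hd p, hd' p, h0 p, h0' p, hp⟩
  have hcu : ∀ p, Continuous (u p) := fun p => hu.comp (continuous_const.prodMk continuous_id)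
  have hcu' : ∀ p, Continuous (u' p) := fun p =>
    continuous_iff_continuousAt.2 fun x => (hd' p x).continuousAt
  let S : Set P := {p | ∀ x ∈ Set.Icc (0:ℝ) (1/2), 0 < u p x}
  have hSopen : IsOpen S := by
    rw [isOpen_iff_eventually]
    intro p hp
    refine isCompact_Icc.eventually_forall_of_forall_eventually (P := fun p x => 0 < u p x) ?_
    intro x hx
    exact hu.continuousAt.eventually (lt_mem_nhds (hp x hx))
  have hSeq : S = ⋂ x ∈ Set.Icc (0:ℝ) (1/2), {p | 0 ≤ u p x} := by
    ext p
    simp only [Set.mem_iInter, Set.mem_ofPred_eq, S]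
    constructor
    · exact fun h x hx => (h x hx).le
    · intro h x hx
      refine lt_of_le_of_ne (h x hx) fun hz => ?_
      rcases eq_or_lt_of_le hx.1 with e | hx0
      · rw [← e, h0] at hz; norm_num at hz
      rcases eq_or_lt_of_le hx.2 with e | hx1
      · rw [e] at hz; exact hne p hz.symm
      have hmin : IsLocalMin (u p) x := by
        filter_upwards [Ioo_mem_nhds hx0 hx1] with y hy
        rw [← hz]; exact h y ⟨hy.1.le, hy.2.le⟩
      have := hill_unique (q p) (hQ p) (u p) (u' p) (hd p) (hd' p) x hz.symm
        (hmin.hasDerivAt_eq_zero (hd p x)) 0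
      rw [h0] at this
      exact one_ne_zero this.1
  have hSclosed : IsClosed S := by
    rw [hSeq]
    refine isClosed_biInter fun x _ => ?_
    exact isClosed_le continuous_const (hu.comp (continuous_id.prodMk continuous_const))
  have hP : PreconnectedSpace P := Subtype.preconnectedSpace isPreconnected_Icc
  let p0 : P := ⟨-M, le_rfl, hle⟩
  let p1 : P := ⟨M + Real.pi ^ 2, hle, le_rfl⟩
  have hS0 : p0 ∈ S := by
    have hq0 : ∀ x, 0 ≤ q p0 x := fun x => by
      have := (abs_le.1 (hεV x)).1
      show 0 ≤ ε * V x - -M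
      linarith
    have hm1 : Monotone (fun x => u p0 x * u' p0 x) := by
      refine monotone_of_hasDerivAt_nonneg (f' := fun x => u' p0 x * u' p0 x + u p0 x * (q p0 x * u p0 x))
        (fun x => (hd p0 x).mul (hd' p0 x)) fun x => ?_
      have := mul_nonneg (hq0 x) (mul_self_nonneg (u p0 x))
      have := mul_self_nonneg (u' p0 x)
      show 0 ≤ u' p0 x * u' p0 x + u p0 x * (q p0 x * u p0 x)
      nlinarith
    have hpos : ∀ x, 0 ≤ x → 0 ≤ u p0 x * u' p0 x := fun x hx => by
      have := hm1 hx
      simpa [h0'] using this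
    have hm2 : MonotoneOn (fun x => u p0 x * u p0 x) (Set.Ici 0) := by
      have hdd : ∀ x, HasDerivAt (fun x => u p0 x * u p0 x) (u' p0 x * u p0 x + u p0 x * u' p0 x) x :=
        fun x => (hd p0 x).mul (hd p0 x)
      refine monotoneOn_of_deriv_nonneg (convex_Ici 0) ((hcu p0).mul (hcu p0)).continuousOn
        (fun x _ => (hdd x).differentiableAt.differentiableWithinAt) fun x hx => ?_
      rw [(hdd x).deriv]
      rw [interior_Ici] at hx
      have := hpos x (le_of_lt hx)
      linarith
    intro x hx
    by_contra hneg
    push Not at hneg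
    obtain ⟨y, hy, hy0⟩ := intermediate_value_Icc' hx.1 (hcu p0).continuousOn
      (show (0:ℝ) ∈ Set.Icc (u p0 x) (u p0 0) from ⟨hneg, by rw [h0]; norm_num⟩)
    have := hm2 (Set.mem_Ici.2 le_rfl) (Set.mem_Ici.2 hy.1) hy.1
    simp only [h0, hy0] at this
    norm_num at this
  have hS1 : p1 ∈ S := by
    rw [IsClopen.eq_univ ⟨hSclosed, hSopen⟩ ⟨p0, hS0⟩]; trivial
  have hcd : ∀ x : ℝ, HasDerivAt (fun x => Real.cos (Real.pi * x)) (-Real.sin (Real.pi * x) * Real.pi) x :=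
    fun x => by simpa using ((hasDerivAt_id x).const_mul Real.pi).cos
  have hsd : ∀ x : ℝ, HasDerivAt (fun x => Real.sin (Real.pi * x)) (Real.cos (Real.pi * x) * Real.pi) x :=
    fun x => by simpa using ((hasDerivAt_id x).const_mul Real.pi).sin
  have hW : ∀ x, HasDerivAt (fun x => u' p1 x * Real.cos (Real.pi * x) + Real.pi * (u p1 x * Real.sin (Real.pi * x)))
      ((q p1 x + Real.pi ^ 2) * u p1 x * Real.cos (Real.pi * x)) x := fun x => by
    refine (((hd' p1 x).mul (hcd x)).add (((hd p1 x).mul (hsd x)).const_mul Real.pi)).congr_deriv ?_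
    ring
  have hanti : AntitoneOn (fun x => u' p1 x * Real.cos (Real.pi * x) + Real.pi * (u p1 x * Real.sin (Real.pi * x)))
      (Set.Icc 0 (1/2)) := by
    refine antitoneOn_of_deriv_nonpos (convex_Icc _ _)
      (fun x _ => (hW x).continuousAt.continuousWithinAt)
      (fun x _ => (hW x).differentiableAt.differentiableWithinAt) fun x hx => ?_
    rw [(hW x).deriv]
    have hx := interior_subset hx
    have hc : 0 ≤ Real.cos (Real.pi * x) := Real.cos_nonneg_of_mem_Icc
      ⟨by nlinarith [Real.pi_pos, hx.1], by nlinarith [Real.pi_pos, hx.2]⟩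
    have h1 : q p1 x + Real.pi ^ 2 ≤ 0 := by
      have := (abs_le.1 (hεV x)).2
      show ε * V x - (M + Real.pi ^ 2) + Real.pi ^ 2 ≤ 0
      linarith
    exact mul_nonpos_of_nonpos_of_nonneg (mul_nonpos_of_nonpos_of_nonneg h1 (hS1 x hx).le) hc
  have h := hanti (Set.left_mem_Icc.2 (by norm_num)) (Set.right_mem_Icc.2 (by norm_num))
    (by norm_num : (0:ℝ) ≤ 1/2)
  have e : Real.pi * (1/2) = Real.pi / 2 := by ring
  simp only [e, h0', Real.cos_pi_div_two, Real.sin_pi_div_two, mul_zero, Real.sin_zero] at h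
  have := hS1 (1/2) (Set.right_mem_Icc.2 (by norm_num))
  have := mul_pos Real.pi_pos this
  linarith

/-- From `u` to the antiperiodicity `u(x+1) = -u(x)` and `u'(1/2) ≠ 0`. -/
lemma hill_shift (q : ℝ → ℝ) {Q : ℝ} (hQ : ∀ t, |q t| ≤ Q) (hqe : ∀ x, q (-x) = q x)
    (hqp : ∀ x, q (x + 1/2) = q x) (u u' : ℝ → ℝ) (hd : ∀ x, HasDerivAt u (u' x) x)
    (hd' : ∀ x, HasDerivAt u' (q x * u x) x) (h0 : u 0 = 1) (h0' : u' 0 = 0) (hh : u (1/2) = 0) :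
    u' (1/2) ≠ 0 ∧ (∀ x, u (x + 1) = - u x) := by
  have hneg : ∀ x : ℝ, HasDerivAt (fun x : ℝ => -x) (-1) x := fun x => (hasDerivAt_id x).neg
  have heven : ∀ x, u (-x) = u x := by
    intro x
    have := hill_unique q hQ (fun x => u (-x) - u x) (fun x => - u' (-x) - u' x)
      (fun x => by
        refine (((hd (-x)).comp x (hneg x)).sub (hd x)).congr_deriv ?_
        ring)
      (fun x => by
        refine ((((hd' (-x)).comp x (hneg x)).neg).sub (hd' x)).congr_deriv ?_
        rw [hqe]; ring) 0 (by simp) (by simp [h0']) x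
    linarith [this.1]
  have hm : u' (1/2) ≠ 0 := fun hm => by
    have := hill_unique q hQ u u' hd hd' (1/2) hh hm 0
    rw [h0] at this
    exact one_ne_zero this.1
  have hh_half : u 2⁻¹ = 0 := by rw [← hh]; norm_num
  refine ⟨hm, fun x => ?_⟩
  have hp1 : ∀ x : ℝ, HasDerivAt (fun x : ℝ => x + 1/2) 1 x := fun x => (hasDerivAt_id x).add_const _
  have hp2 : ∀ x : ℝ, HasDerivAt (fun x : ℝ => -x + 1/2) (-1) x := fun x => (hneg x).add_const _
  have := hill_unique q hQ (fun x => u (x + 1/2) + u (-x + 1/2)) (fun x => u' (x + 1/2) - u' (-x + 1/2))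
      (fun x => by
        refine (((hd (x+1/2)).comp x (hp1 x)).add ((hd (-x+1/2)).comp x (hp2 x))).congr_deriv ?_
        ring)
      (fun x => by
        refine (((hd' (x+1/2)).comp x (hp1 x)).sub ((hd' (-x+1/2)).comp x (hp2 x))).congr_deriv ?_
        rw [hqp, hqp, hqe]; ring) 0 (by simp [hh_half]) (by simp) (x + 1/2)
  have h1 := this.1
  rw [show x + 1/2 + 1/2 = x + 1 by ring, show -(x + 1/2) + 1/2 = -x by ring, heven] at h1
  linarith

lemma dirac_finish (q : ℝ → ℝ) (hq : Continuous q)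
    (Ψ Ψ' : ℝ → ℂ) (hd : ∀ x, HasDerivAt Ψ (Ψ' x) x)
    (hd' : ∀ x, HasDerivAt Ψ' ((q x : ℂ) * Ψ x) x) (hs : ∀ x, Ψ (x + 1/2) = Complex.I * Ψ x)
    (w : ℝ) (hw : w ≠ 0) (hW : ∀ x, ((starRingEnd ℂ) (Ψ x) * Ψ' x).im = w)
    (hn : (∫ x in (0:ℝ)..1, ‖Ψ x‖ ^ 2) = 1) :
    ContDiff ℝ 2 Ψ ∧ Ψ ≠ 0 ∧ (∀ x, deriv (deriv Ψ) x = (q x : ℂ) * Ψ x) ∧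
      (∀ Φ : ℝ → ℂ, ContDiff ℝ 2 Φ → (∀ x, deriv (deriv Φ) x = (q x : ℂ) * Φ x) →
        (∀ x, Φ (x + 1/2) = Complex.I * Φ x) → ∃ c : ℂ, ∀ x, Φ x = c * Ψ x) ∧
      2 * Complex.I * (∫ x in (0:ℝ)..1, (starRingEnd ℂ) (Ψ x) * deriv Ψ x) ≠ 0 := by
  have e1 : deriv Ψ = Ψ' := funext fun x => (hd x).deriv
  have e2 : deriv Ψ' = fun x => (q x : ℂ) * Ψ x := funext fun x => (hd' x).deriv
  have hc : Continuous Ψ := continuous_iff_continuousAt.2 fun x => (hd x).continuousAt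
  have hc' : Continuous Ψ' := continuous_iff_continuousAt.2 fun x => (hd' x).continuousAt
  have hne : ∀ x, Ψ x ≠ 0 := fun x hx => hw (by rw [← hW x, hx]; simp)
  have shift : ∀ f f' : ℝ → ℂ, (∀ x, HasDerivAt f (f' x) x) →
      (∀ x, f (x + 1/2) = Complex.I * f x) → ∀ x, f' (x + 1/2) = Complex.I * f' x := by
    intro f f' hf h x
    have h1 : HasDerivAt (fun x => f (x + 1/2)) (f' (x + 1/2)) x :=
      (hf (x + 1/2)).comp_add_const x (1/2)
    rw [funext h] at h1
    exact h1.unique ((hf x).const_mul Complex.I)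
  refine ⟨?_, fun h => hne 0 (by rw [h]; rfl), ?_, ?_, ?_⟩
  · rw [show (2 : WithTop ℕ∞) = 1 + 1 by norm_num, contDiff_succ_iff_deriv]
    refine ⟨fun x => (hd x).differentiableAt, by simp, ?_⟩
    rw [e1, contDiff_one_iff_deriv, e2]
    exact ⟨fun x => (hd' x).differentiableAt, (Complex.continuous_ofReal.comp hq).mul hc⟩
  · intro x; rw [e1, e2]
  · intro Φ hΦ hΦe hΦs
    have hf : ∀ x, HasDerivAt Φ (deriv Φ x) x := fun x =>
      (hΦ.differentiable (by norm_num) x).hasDerivAt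
    have hf' : ∀ x, HasDerivAt (deriv Φ) ((q x : ℂ) * Φ x) x := fun x => by
      rw [← hΦe x]
      rw [show (2 : WithTop ℕ∞) = 1 + 1 by norm_num, contDiff_succ_iff_deriv] at hΦ
      exact (hΦ.2.2.differentiable (by norm_num) x).hasDerivAt
    have hwd : ∀ x, HasDerivAt (fun x => Φ x * Ψ' x - deriv Φ x * Ψ x) 0 x := fun x =>
      (((hf x).mul (hd' x)).sub ((hf' x).mul (hd x))).congr_deriv (by ring)
    have hconst := is_const_of_deriv_eq_zero (fun x => (hwd x).differentiableAt)
      (fun x => (hwd x).deriv)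
    have hw0 : ∀ x, Φ x * Ψ' x - deriv Φ x * Ψ x = 0 := by
      intro x
      have h := hconst (x + 1/2) x
      simp only [hΦs, hs, shift Φ _ hf hΦs, shift Ψ _ hd hs] at h
      linear_combination (-1/2) * h + (1/2) * (Φ x * Ψ' x - deriv Φ x * Ψ x) * Complex.I_sq
    have hqd : ∀ x, HasDerivAt (fun x => Φ x / Ψ x) 0 x := fun x =>
      ((hf x).div (hd x) (hne x)).congr_deriv (by
        rw [div_eq_zero_iff]; left; linear_combination - hw0 x)
    have hqc := is_const_of_deriv_eq_zero (fun x => (hqd x).differentiableAt)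
      (fun x => (hqd x).deriv)
    refine ⟨Φ 0 / Ψ 0, fun x => ?_⟩
    rw [← hqc x 0, div_mul_cancel₀ _ (hne x)]
  · rw [e1]
    refine mul_ne_zero (by simp) fun h => hw ?_
    have hi : IntervalIntegrable (fun x => (starRingEnd ℂ) (Ψ x) * Ψ' x) volume 0 1 :=
      ((Complex.continuous_conj.comp hc).mul hc').intervalIntegrable _ _
    have := Complex.imCLM.intervalIntegral_comp_comm hi
    simp only [Complex.imCLM_apply, hW, h] at this
    simpa using this

/-- Dirac points for generic coupling: discreteness of the exceptional set. -/
theorem dirac_points_generic_coupling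
    (V : ℝ → ℝ) (hV : ContDiff ℝ (⊤ : ℕ∞) V) (hVeven : ∀ x, V (-x) = V x)
    (hVhalf : ∀ x, V (x + 1/2) = V x) :
    ∃ ε₀ > (0:ℝ), ∃ C0 > (0:ℝ), ∃ C1 > (0:ℝ), ∃ 𝒞 : Set ℝ,
      (∀ ε ∈ 𝒞, ε₀ ≤ |ε|) ∧
      (∀ x : ℝ, ¬ AccPt x (Filter.principal 𝒞)) ∧
      ∀ ε : ℝ, ε ∉ 𝒞 →
        ∃ E : ℝ, |E| ≤ C0 * |ε| + C1 ∧
          ∃ Φ₁ : ℝ → ℂ, ContDiff ℝ 2 Φ₁ ∧ Φ₁ ≠ 0 ∧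
            (∀ x, -(deriv (deriv Φ₁) x) + (ε : ℂ) * (V x : ℂ) * Φ₁ x = (E : ℂ) * Φ₁ x) ∧
            (∀ x, Φ₁ (x + 1/2) = Complex.I * Φ₁ x) ∧
            (∀ Φ : ℝ → ℂ, ContDiff ℝ 2 Φ →
              (∀ x, -(deriv (deriv Φ) x) + (ε : ℂ) * (V x : ℂ) * Φ x = (E : ℂ) * Φ x) →
              (∀ x, Φ (x + 1/2) = Complex.I * Φ x) → ∃ c : ℂ, ∀ x, Φ x = c * Φ₁ x) ∧
            (∫ x in (0:ℝ)..1, ‖Φ₁ x‖ ^ 2) = 1 ∧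
            2 * Complex.I * (∫ x in (0:ℝ)..1, (starRingEnd ℂ) (Φ₁ x) * deriv Φ₁ x) ≠ 0 := by
  have hVc : Continuous V := hV.continuous
  obtain ⟨B, hB⟩ : ∃ B, ∀ x, |V x| ≤ B := by
    obtain ⟨B, hB⟩ := (isCompact_Icc (a := (0:ℝ)) (b := 1/2)).exists_bound_of_continuousOn
      hVc.continuousOn
    refine ⟨B, fun x => ?_⟩
    have hper : Function.Periodic V (1/2) := hVhalf
    obtain ⟨y, hy, he⟩ := hper.exists_mem_Ico₀ (by norm_num) x
    rw [he]
    exact hB y ⟨hy.1, hy.2.le⟩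
  have hB0 : 0 ≤ B := (abs_nonneg _).trans (hB 0)
  refine ⟨1, one_pos, B + 1, by linarith, Real.pi ^ 2, by positivity, ∅, by simp, ?_, ?_⟩
  · intro x h
    rw [accPt_iff_frequently] at h
    simp at h
  intro ε _
  obtain ⟨E, hE, u, u', hd, hd', h0, h0', hh⟩ := hill_energy V hVc hB ε
  refine ⟨E, hE.trans (by nlinarith [abs_nonneg ε]), ?_⟩
  let q : ℝ → ℝ := fun x => ε * V x - E
  have hqc : Continuous q := (continuous_const.mul hVc).sub continuous_const
  have hQ : ∀ t, |q t| ≤ |ε| * B + |E| := fun t =>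
    (abs_sub _ _).trans (by rw [abs_mul]; gcongr; exact hB t)
  have hqp : ∀ x, q (x + 1/2) = q x := fun x => by simp only [q, hVhalf]
  obtain ⟨hm, hanti⟩ := hill_shift q hQ (fun x => by simp only [q, hVeven]) hqp u u' hd hd' h0 h0' hh
  have hds : ∀ x, HasDerivAt (fun x => u (x + 1/2)) (u' (x + 1/2)) x := fun x =>
    (hd (x + 1/2)).comp_add_const x (1/2)
  have hds' : ∀ x, HasDerivAt (fun x => u' (x + 1/2)) (q x * u (x + 1/2)) x := fun x => by
    rw [← hqp x]
    exact (hd' (x + 1/2)).comp_add_const x (1/2)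
  have hWd : ∀ x, HasDerivAt (fun x => u (x + 1/2) * u' x - u x * u' (x + 1/2)) 0 x := fun x =>
    (((hds x).mul (hd' x)).sub ((hd x).mul (hds' x))).congr_deriv (by simp only [q]; ring)
  have hWc : ∀ x, u (x + 1/2) * u' x - u x * u' (x + 1/2) = - u' (1/2) := fun x => by
    have := is_const_of_deriv_eq_zero (fun x => (hWd x).differentiableAt)
      (fun x => (hWd x).deriv) x 0
    simp only [h0, h0', zero_add] at this
    rw [this]; ring
  let Ψ : ℝ → ℂ := fun x => (u x : ℂ) - Complex.I * (u (x + 1/2) : ℂ)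
  let Ψ' : ℝ → ℂ := fun x => (u' x : ℂ) - Complex.I * (u' (x + 1/2) : ℂ)
  have hΨd : ∀ x, HasDerivAt Ψ (Ψ' x) x := fun x =>
    (hd x).ofReal_comp.sub ((hds x).ofReal_comp.const_mul Complex.I)
  have hΨd' : ∀ x, HasDerivAt Ψ' ((q x : ℂ) * Ψ x) x := fun x =>
    ((hd' x).ofReal_comp.sub ((hds' x).ofReal_comp.const_mul Complex.I)).congr_deriv (by
      simp only [Ψ, q]; push_cast; ring)
  have hΨs : ∀ x, Ψ (x + 1/2) = Complex.I * Ψ x := fun x => by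
    simp only [Ψ]
    rw [show x + 1/2 + 1/2 = x + 1 by ring, hanti]
    push_cast
    linear_combination (u (x + 1/2) : ℂ) * Complex.I_sq
  have hΨW : ∀ x, ((starRingEnd ℂ) (Ψ x) * Ψ' x).im = - u' (1/2) := fun x => by
    rw [← hWc x]
    simp [Ψ, Ψ']
    ring
  have hΨne : ∀ x, Ψ x ≠ 0 := fun x hx => hm (by
    have := hΨW x
    rw [hx] at this
    simpa using this)
  have hΨc : Continuous Ψ := continuous_iff_continuousAt.2 fun x => (hΨd x).continuousAt
  have hNpos : 0 < ∫ x in (0:ℝ)..1, ‖Ψ x‖ ^ 2 :=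
    intervalIntegral.intervalIntegral_pos_of_pos ((hΨc.norm.pow 2).intervalIntegrable _ _)
      (fun x => pow_pos (norm_pos_iff.2 (hΨne x)) 2) one_pos
  set N := ∫ x in (0:ℝ)..1, ‖Ψ x‖ ^ 2 with hN
  let a : ℝ := (Real.sqrt N)⁻¹
  have ha : 0 < a := inv_pos.2 (Real.sqrt_pos.2 hNpos)
  have ha2 : a ^ 2 * N = 1 := by
    simp only [a, inv_pow]
    rw [Real.sq_sqrt hNpos.le, inv_mul_cancel₀ hNpos.ne']
  have hnorm : (∫ x in (0:ℝ)..1, ‖(a : ℂ) * Ψ x‖ ^ 2) = 1 := by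
    simp only [norm_mul, mul_pow, Complex.norm_real, Real.norm_eq_abs, sq_abs]
    rw [intervalIntegral.integral_const_mul, ← hN, ha2]
  have hs1 : ∀ x, (a : ℂ) * Ψ (x + 1/2) = Complex.I * ((a : ℂ) * Ψ x) := fun x => by
    rw [hΨs]; ring
  obtain ⟨r1, r2, r3, r4, r5⟩ := dirac_finish q hqc (fun x => (a : ℂ) * Ψ x)
    (fun x => (a : ℂ) * Ψ' x) (fun x => (hΨd x).const_mul _)
    (fun x => ((hΨd' x).const_mul (a : ℂ)).congr_deriv (by ring)) hs1 (a ^ 2 * (- u' (1/2)))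
    (mul_ne_zero (by positivity) (neg_ne_zero.2 hm))
    (fun x => by
      rw [← hΨW x, map_mul, Complex.conj_ofReal,
        show (a : ℂ) * (starRingEnd ℂ) (Ψ x) * ((a : ℂ) * Ψ' x)
          = ((a ^ 2 : ℝ) : ℂ) * ((starRingEnd ℂ) (Ψ x) * Ψ' x) by push_cast; ring,
        Complex.im_ofReal_mul]) hnorm
  refine ⟨fun x => (a : ℂ) * Ψ x, r1, r2, fun x => ?_, hs1, fun Φ hΦ hΦe hΦs => ?_, hnorm, r5⟩
  · rw [r3]; simp only [q]; push_cast; ring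
  · refine r4 Φ hΦ (fun x => ?_) hΦs
    simp only [q]; push_cast
    linear_combination - hΦe x
end

section
/- Analytic selection of real zeros. Let F : ℂ × ℂ → ℂ be analytic on a neighborhood of (0, 0) with F(0, 0) = 0, and suppose that whenever (z, t) lies in this neighborhood with F(z, t) = 0 and t real, then z is real. Then there exist r > 0 and an analytic function g on the disc {t ∈ ℂ : |t| < r} with g(0) = 0 such that F(g(t), t) = 0 for all |t| < r. -/
open Filter

theorem asz_integral {D : ℂ × ℂ → ℂ} (hD : AnalyticAt ℂ D 0)
    (L : ℝ → (ℂ × ℂ) →L[ℂ] (ℂ × ℂ)) (hL : Continuous L)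
    (hL1 : ∀ s ∈ Set.Icc (0:ℝ) 1, ‖L s‖ ≤ 1) :
    AnalyticAt ℂ (fun v => ∫ s in (0:ℝ)..1, D (L s v)) 0 := by
  obtain ⟨d, ε, hd⟩ := hD
  have hcont : ∀ n, Continuous (fun s => (d n).compContinuousLinearMap (fun _ => L s)) := by
    intro n
    have h := (ContinuousMultilinearMap.compContinuousLinearMapContinuousMultilinear ℂ
      (fun _ : Fin n => ℂ × ℂ) (fun _ : Fin n => ℂ × ℂ) ℂ).cont
    have h2 : Continuous (fun s : ℝ => (fun _ : Fin n => L s)) := continuous_pi fun _ => hL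
    exact (h.comp h2).clm_apply continuous_const
  refine ⟨fun n => ∫ s in (0:ℝ)..1, (d n).compContinuousLinearMap (fun _ => L s), ε, ?_, hd.r_pos, ?_⟩
  · refine hd.r_le.trans (FormalMultilinearSeries.radius_le_of_le (fun n ↦ ?_))
    have := intervalIntegral.norm_integral_le_of_norm_le_const (a := (0:ℝ)) (b := 1) (C := ‖d n‖)
      (f := fun s => (d n).compContinuousLinearMap (fun _ => L s)) ?_
    · simpa using this
    · intro s hs
      rw [Set.uIoc_of_le zero_le_one] at hs
      refine (ContinuousMultilinearMap.norm_compContinuousLinearMap_le _ _).trans ?_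
      refine mul_le_of_le_one_right (norm_nonneg _) ?_
      exact Finset.prod_le_one (fun _ _ => norm_nonneg _) (fun _ _ => hL1 s ⟨hs.1.le, hs.2⟩)
  · intro y hy
    have hyr : (‖y‖₊ : ENNReal) < d.radius := by
      refine lt_of_lt_of_le ?_ hd.r_le
      simpa [Metric.mem_eball, edist_zero_right, enorm_eq_nnnorm] using hy
    have hsum := d.summable_norm_mul_pow hyr
    have key : HasSum (fun n => ∫ s in (0:ℝ)..1, (d n) (fun _ => L s y))
        (∫ s in (0:ℝ)..1, D (L s y)) := by
      refine intervalIntegral.hasSum_integral_of_dominated_convergence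
        (fun n _ => ‖d n‖ * (‖y‖₊ : ℝ) ^ n) ?_ ?_ ?_ ?_ ?_
      · intro n
        refine Continuous.aestronglyMeasurable ?_
        exact (d n).cont.comp (continuous_pi fun _ => hL.clm_apply continuous_const)
      · refine fun n => MeasureTheory.ae_of_all _ fun s hs => ?_
        rw [Set.uIoc_of_le zero_le_one] at hs
        refine ((d n).le_opNorm _).trans ?_
        gcongr
        simp only [Finset.prod_const, Finset.card_univ, Fintype.card_fin]
        gcongr
        exact ((L s).le_opNorm y).trans (mul_le_of_le_one_left (norm_nonneg _) (hL1 s ⟨hs.1.le, hs.2⟩))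
      · exact MeasureTheory.ae_of_all _ fun s hs => hsum
      · exact intervalIntegrable_const
      · refine MeasureTheory.ae_of_all _ fun s hs => ?_
        rw [Set.uIoc_of_le zero_le_one] at hs
        have : L s y ∈ Metric.eball (0 : ℂ × ℂ) ε := by
          rw [Metric.mem_eball, edist_zero_right] at hy ⊢
          refine lt_of_le_of_lt ?_ hy
          have := ((L s).le_opNorm y).trans (mul_le_of_le_one_left (norm_nonneg _) (hL1 s ⟨hs.1.le, hs.2⟩))
          simpa [enorm_le_iff_norm_le] using this
        simpa using hd.hasSum this
    simp only [zero_add]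
    convert! key using 1
    funext n
    have := (ContinuousMultilinearMap.apply ℂ (fun _ : Fin n => ℂ × ℂ) ℂ (fun _ => y)).intervalIntegral_comp_comm
      ((hcont n).intervalIntegrable (μ := MeasureTheory.volume) 0 1)
    simpa using this.symm

/-- division in the first variable -/
noncomputable def aszHd (F : ℂ × ℂ → ℂ) : ℂ × ℂ → ℂ :=
  fun v => dslope (fun x => F (x, v.2)) 0 v.1

theorem asz_hadamard {F : ℂ × ℂ → ℂ} (hF : AnalyticAt ℂ F 0) : AnalyticAt ℂ (aszHd F) 0 := by
  have hD : AnalyticAt ℂ (fun v => fderiv ℂ F v (1, 0)) 0 :=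
    ((ContinuousLinearMap.apply ℂ ℂ ((1:ℂ), (0:ℂ))).analyticAt _).comp hF.fderiv
  let L : ℝ → (ℂ × ℂ) →L[ℂ] (ℂ × ℂ) := fun s =>
    (s : ℂ) • (ContinuousLinearMap.inl ℂ ℂ ℂ).comp (ContinuousLinearMap.fst ℂ ℂ ℂ) +
      (ContinuousLinearMap.inr ℂ ℂ ℂ).comp (ContinuousLinearMap.snd ℂ ℂ ℂ)
  have hLv : ∀ s v, L s v = ((s:ℂ) * v.1, v.2) := by
    intro s v; simp [L]
  have hL : Continuous L := by fun_prop
  have hL1 : ∀ s ∈ Set.Icc (0:ℝ) 1, ‖L s‖ ≤ 1 := by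
    intro s hs
    refine ContinuousLinearMap.opNorm_le_bound _ zero_le_one fun v => ?_
    rw [hLv, one_mul, Prod.norm_def, Prod.norm_def]
    refine max_le_max ?_ le_rfl
    rw [norm_mul, Complex.norm_real, Real.norm_of_nonneg hs.1]
    exact mul_le_of_le_one_left (norm_nonneg _) hs.2
  refine (asz_integral hD L hL hL1).congr ?_
  obtain ⟨r, hr, hr2⟩ := Metric.eventually_nhds_iff_ball.1 hF.eventually_analyticAt
  filter_upwards [Metric.ball_mem_nhds (0 : ℂ × ℂ) hr] with v hv
  obtain ⟨z, t⟩ := v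
  have hin : ∀ s ∈ Set.Icc (0:ℝ) 1, AnalyticAt ℂ F ((s:ℂ) * z, t) := by
    intro s hs
    refine hr2 _ ?_
    rw [mem_ball_zero_iff] at hv ⊢
    rw [← hLv s (z, t)]
    exact lt_of_le_of_lt (((L s).le_opNorm _).trans
      (mul_le_of_le_one_left (norm_nonneg _) (hL1 s hs))) hv
  simp only [hLv, aszHd]
  by_cases hz : z = 0
  · subst hz
    rw [dslope_same]
    have h1 : HasDerivAt (fun x : ℂ => F (x, t)) (fderiv ℂ F (0, t) (1, 0)) 0 := by
      have h := (hin 0 (by simp)).differentiableAt.hasFDerivAt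
      simp only [mul_zero] at h
      have h2 : HasDerivAt (fun x : ℂ => (x, t)) ((1:ℂ), (0:ℂ)) 0 :=
        (hasDerivAt_id _).prodMk (hasDerivAt_const _ _)
      exact h.comp_hasDerivAt (0:ℂ) h2
    rw [h1.deriv]
    simp
  · rw [dslope_of_ne _ hz, slope_def_field]
    rw [eq_div_iff (by simpa using hz), sub_zero]
    have h1 : ∀ s ∈ Set.uIcc (0:ℝ) 1, HasDerivAt (fun s : ℝ => F ((s:ℂ) * z, t))
        (fderiv ℂ F ((s:ℂ) * z, t) (1, 0) * z) s := by
      intro s hs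
      rw [Set.uIcc_of_le zero_le_one] at hs
      have h := (hin s hs).differentiableAt.hasFDerivAt.restrictScalars ℝ
      have h2 : HasDerivAt (fun s : ℝ => ((s:ℂ) * z, t)) (z, (0:ℂ)) s := by
        refine HasDerivAt.prodMk ?_ (hasDerivAt_const _ _)
        simpa using (Complex.ofRealCLM.hasDerivAt (x := s)).mul_const z
      have h3 := h.comp_hasDerivAt s h2
      convert! h3 using 1
      have : (z, (0:ℂ)) = z • ((1:ℂ), (0:ℂ)) := by simp
      rw [ContinuousLinearMap.coe_restrictScalars', this, map_smul, smul_eq_mul, mul_comm]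
    have h2 := intervalIntegral.integral_eq_sub_of_hasDerivAt h1 ?_
    · rw [intervalIntegral.integral_mul_const] at h2
      simpa using h2
    · refine ContinuousOn.intervalIntegrable ?_
      intro s hs
      rw [Set.uIcc_of_le zero_le_one] at hs
      refine ContinuousAt.continuousWithinAt ?_
      have hc := (hin s hs).fderiv.continuousAt
      have h2 : ContinuousAt (fun s : ℝ => ((s:ℂ) * z, t)) s := by fun_prop
      have h3 := ContinuousAt.comp (x := s) (f := fun s : ℝ => ((s:ℂ) * z, t)) hc h2
      exact (h3.clm_apply continuousAt_const).mul continuousAt_const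

theorem asz_iter_hd (F : ℂ × ℂ → ℂ) (i : ℕ) (z t : ℂ) :
    (aszHd^[i] F) (z, t) = ((Function.swap dslope (0:ℂ))^[i] (fun x => F (x, t))) z := by
  induction i generalizing F with
  | zero => rfl
  | succ n ih =>
    rw [Function.iterate_succ_apply, Function.iterate_succ_apply, ih]
    rfl

theorem asz_iter_hd_analytic {F : ℂ × ℂ → ℂ} (hF : AnalyticAt ℂ F 0) (i : ℕ) :
    AnalyticAt ℂ (aszHd^[i] F) 0 := by
  induction i with
  | zero => exact hF
  | succ n ih => rw [Function.iterate_succ_apply']; exact asz_hadamard ih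

theorem asz_iter_dslope {f : ℂ → ℂ} (hf : AnalyticAt ℂ f 0) (i : ℕ) :
    ((Function.swap dslope (0:ℂ))^[i] f) 0 = iteratedDeriv i f 0 / (i.factorial : ℂ) := by
  have h := hf.hasFPowerSeriesAt.has_fpower_series_iterate_dslope_fslope i
  rw [← h.coeff_zero 1, ← FormalMultilinearSeries.coeff.eq_1,
    FormalMultilinearSeries.coeff_iterate_fslope]
  simp [FormalMultilinearSeries.coeff_ofScalars]

theorem asz_expand (F : ℂ × ℂ → ℂ) (k : ℕ) (z t : ℂ) :
    F (z, t) = ∑ i ∈ Finset.range k, (aszHd^[i] F) (0, t) * z ^ i + z ^ k * (aszHd^[k] F) (z, t) := by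
  induction k with
  | zero => simp
  | succ n ih =>
    rw [Finset.sum_range_succ, ih]
    have : (aszHd^[n] F) (z, t) = (aszHd^[n] F) (0, t) + z * (aszHd^[n+1] F) (z, t) := by
      rw [Function.iterate_succ_apply']
      have := sub_smul_dslope (fun x => (aszHd^[n] F) (x, t)) 0 z
      simp only [sub_zero, smul_eq_mul] at this
      change _ = _ + z * dslope (fun x => (aszHd^[n] F) (x, t)) 0 z
      rw [this]; ring
    rw [this]; ring

theorem asz_slice {F : ℂ × ℂ → ℂ} {z t : ℂ} (hF : AnalyticAt ℂ F (z, t)) :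
    AnalyticAt ℂ (fun x => F (x, t)) z :=
  hF.comp₂ analyticAt_id analyticAt_const

theorem asz_slice_deriv {F : ℂ × ℂ → ℂ} {z t : ℂ} (hF : AnalyticAt ℂ F (z, t)) :
    deriv (fun x => F (x, t)) z = fderiv ℂ F (z, t) (1, 0) := by
  have h := hF.differentiableAt.hasFDerivAt
  have h2 : HasDerivAt (fun x : ℂ => (x, t)) ((1:ℂ), (0:ℂ)) z :=
    (hasDerivAt_id _).prodMk (hasDerivAt_const _ _)
  exact (h.comp_hasDerivAt z h2).deriv

theorem asz_iterDeriv {F : ℂ × ℂ → ℂ} (hF : AnalyticAt ℂ F 0) (n : ℕ) :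
    AnalyticAt ℂ (fun v : ℂ × ℂ => iteratedDeriv n (fun x => F (x, v.2)) v.1) 0 := by
  induction n with
  | zero => simpa using hF
  | succ n ih =>
    have hD := ((ContinuousLinearMap.apply ℂ ℂ ((1:ℂ), (0:ℂ))).analyticAt _).comp ih.fderiv
    refine hD.congr ?_
    filter_upwards [ih.eventually_analyticAt] with v hv
    obtain ⟨z, t⟩ := v
    rw [iteratedDeriv_succ]
    exact (asz_slice_deriv hv).symm

open scoped ContDiff in
theorem asz_implicit {D : ℂ × ℂ → ℂ} (hD : AnalyticAt ℂ D 0) (h0 : D (0, 0) = 0)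
    (h1 : deriv (fun x => D (x, 0)) 0 ≠ 0) :
    ∃ φ : ℂ → ℂ, AnalyticAt ℂ φ 0 ∧ φ 0 = 0 ∧ ∀ᶠ t in nhds 0, D (φ t, t) = 0 := by
  let f : ℂ × ℂ → ℂ := fun v => D (v.2, v.1)
  have hf : AnalyticAt ℂ f ((0:ℂ), (0:ℂ)) :=
    AnalyticAt.comp₂ (h := D) hD analyticAt_snd analyticAt_fst
  have cdf : ContDiffAt ℂ ω f ((0:ℂ), (0:ℂ)) := hf.contDiffAt
  have hd : HasDerivAt (fun x => D (x, 0)) (fderiv ℂ f (0, 0) (0, 1)) 0 := by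
    have h := hf.differentiableAt.hasFDerivAt
    have h2 : HasDerivAt (fun x : ℂ => ((0:ℂ), x)) ((0:ℂ), (1:ℂ)) 0 :=
      (hasDerivAt_const _ _).prodMk (hasDerivAt_id _)
    exact (h.comp_hasDerivAt (0:ℂ) h2)
  rw [hd.deriv] at h1
  have hinv : (fderiv ℂ f (0, 0) ∘L .inr ℂ ℂ ℂ).IsInvertible := by
    refine ⟨ContinuousLinearEquiv.unitsEquivAut ℂ (Units.mk0 _ h1), ?_⟩
    ext
    simp
  refine ⟨cdf.implicitFunction (by simp) hinv, ?_, ?_, ?_⟩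
  · exact (cdf.contDiffAt_implicitFunction (by simp) hinv).analyticAt
  · exact cdf.implicitFunction_apply_self (by simp) hinv
  · have := cdf.eventually_apply_implicitFunction (by simp) hinv
    simpa [f, h0] using this

theorem asz_normal {F : ℂ × ℂ → ℂ} (hF : AnalyticAt ℂ F 0) {k : ℕ} (hk : 1 ≤ k)
    (hord : analyticOrderAt (fun z => F (z, 0)) 0 = k) :
    ∃ φ : ℂ → ℂ, AnalyticAt ℂ φ 0 ∧ φ 0 = 0 ∧ ∃ (a : ℕ → ℂ → ℂ) (u : ℂ × ℂ → ℂ),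
      (∀ i, AnalyticAt ℂ (a i) 0) ∧ AnalyticAt ℂ u 0 ∧ u 0 ≠ 0 ∧ (∀ i < k, a i 0 = 0) ∧
      (∀ᶠ t in nhds 0, a (k-1) t = 0) ∧
      ∀ z t, F (z + φ t, t) = ∑ i ∈ Finset.range k, a i t * z ^ i + z ^ k * u (z, t) := by
  have hs : AnalyticAt ℂ (fun z => F (z, 0)) 0 := asz_slice hF
  have hlow : ∀ i < k, iteratedDeriv i (fun z => F (z, 0)) 0 = 0 :=
    (natCast_le_analyticOrderAt_iff_iteratedDeriv_eq_zero hs).1 hord.ge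
  have hhigh : iteratedDeriv k (fun z => F (z, 0)) 0 ≠ 0 := by
    intro h
    have := (natCast_le_analyticOrderAt_iff_iteratedDeriv_eq_zero (n := k + 1) hs).2 (by
      intro i hi
      rcases Nat.lt_succ_iff_lt_or_eq.1 hi with h' | h'
      · exact hlow i h'
      · rw [h', h])
    rw [hord] at this
    have := Nat.cast_le.1 this
    omega
  obtain ⟨φ, hφ, hφ0, hφ1⟩ := asz_implicit (asz_iterDeriv hF (k-1)) (hlow _ (by omega)) (by
    simp only
    rw [← iteratedDeriv_succ, Nat.sub_add_cancel hk]
    exact hhigh)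
  refine ⟨φ, hφ, hφ0, ?_⟩
  let G : ℂ × ℂ → ℂ := fun v => F (v.1 + φ v.2, v.2)
  have hG : AnalyticAt ℂ G 0 := by
    refine AnalyticAt.comp₂ (h := F) (by simp only [Prod.fst_zero, Prod.snd_zero, hφ0, add_zero]; exact hF) ?_ analyticAt_snd
    exact analyticAt_fst.add (AnalyticAt.comp (g := φ) (by simpa using hφ) analyticAt_snd)
  have hG0 : (fun x => G (x, 0)) = fun z => F (z, 0) := by
    funext x; simp [G, hφ0]
  have hcoef : ∀ i, ∀ᶠ t in nhds (0:ℂ), (aszHd^[i] G) (0, t) =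
      iteratedDeriv i (fun x => G (x, t)) 0 / (i.factorial : ℂ) := by
    intro i
    have h1 : Tendsto (fun t : ℂ => ((0:ℂ), t)) (nhds 0) (nhds 0) := by
      have : Continuous (fun t : ℂ => ((0:ℂ), t)) := by fun_prop
      exact this.tendsto 0
    filter_upwards [h1.eventually hG.eventually_analyticAt] with t ht
    rw [asz_iter_hd, asz_iter_dslope (asz_slice ht)]
  refine ⟨fun i t => (aszHd^[i] G) (0, t), aszHd^[k] G, ?_, asz_iter_hd_analytic hG k, ?_, ?_, ?_, ?_⟩
  · intro i
    exact AnalyticAt.comp₂ (h := aszHd^[i] G) (asz_iter_hd_analytic hG i) analyticAt_const analyticAt_id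
  · have := (hcoef k).self_of_nhds
    change (aszHd^[k] G) (0, 0) ≠ 0
    rw [this, hG0]
    exact div_ne_zero hhigh (by exact_mod_cast k.factorial_ne_zero)
  · intro i hi
    have := (hcoef i).self_of_nhds
    simp only [this, hG0, hlow i hi, zero_div]
  · filter_upwards [hcoef (k-1), hφ1] with t ht ht1
    rw [ht]
    have : iteratedDeriv (k-1) (fun x => G (x, t)) 0 = 0 := by
      refine Eq.trans ?_ ht1
      have := congrFun (iteratedDeriv_comp_add_const (k-1) (fun x => F (x, t)) (φ t)) 0
      simpa [G] using this
    simp [this]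
  · intro z t
    exact asz_expand G k z t

open Polynomial in
theorem asz_poly {k : ℕ} (hk : 1 ≤ k) {c : ℕ → ℂ} {u0 : ℂ} (hu : u0 ≠ 0) (hc : c (k-1) = 0)
    {i0 : ℕ} (hi0 : i0 < k) (hci : c i0 ≠ 0) :
    ∃ w0 w1 : ℂ, w0 ≠ w1 ∧
      (∑ i ∈ Finset.range k, c i * w0 ^ i + w0 ^ k * u0 = 0) ∧
      (∑ i ∈ Finset.range k, c i * w1 ^ i + w1 ^ k * u0 = 0) ∧
      (∀ w2, ∀ᶠ w in nhdsWithin w2 {w2}ᶜ, ∑ i ∈ Finset.range k, c i * w ^ i + w ^ k * u0 ≠ 0) ∧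
      ∃ k', 1 ≤ k' ∧ k' < k ∧ analyticOrderAt
        (fun w => ∑ i ∈ Finset.range k, c i * (w + w0) ^ i + (w + w0) ^ k * u0) 0 = (k' : ℕ) := by
  let P : ℂ[X] := ∑ i ∈ Finset.range k, C (c i) * X ^ i + X ^ k * C u0
  have hev : ∀ w, P.eval w = ∑ i ∈ Finset.range k, c i * w ^ i + w ^ k * u0 := by
    intro w
    simp only [P, eval_add, eval_finsetSum, eval_mul, eval_pow, eval_X, eval_C]
  have hcoef : ∀ j < k, P.coeff j = c j := by
    intro j hj
    simp only [P, coeff_add, finsetSum_coeff, coeff_C_mul, coeff_X_pow, coeff_mul_C]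
    simp [hj, hj.ne]
  have hcoefk : P.coeff k = u0 := by
    simp only [P, coeff_add, finsetSum_coeff, coeff_C_mul, coeff_X_pow, coeff_mul_C]
    rw [Finset.sum_eq_zero]
    · simp
    · intro i hi
      simp [(Finset.mem_range.1 hi).ne']
  have hP0 : P ≠ 0 := by
    intro h; rw [h] at hcoefk; simp at hcoefk; exact hu hcoefk.symm
  have hdeg : P.natDegree = k := by
    refine le_antisymm ?_ (le_natDegree_of_ne_zero (by rw [hcoefk]; exact hu))
    rw [natDegree_le_iff_coeff_eq_zero]
    intro N hN
    simp only [P, coeff_add, finsetSum_coeff, coeff_C_mul, coeff_X_pow, coeff_mul_C]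
    rw [Finset.sum_eq_zero]
    · simp [hN.ne']
    · intro i hi
      have := Finset.mem_range.1 hi
      simp [show N ≠ i by omega]
  obtain ⟨w0, hw0⟩ := IsAlgClosed.exists_root P (by
    rw [degree_eq_natDegree hP0, hdeg]; exact_mod_cast (by omega : k ≠ 0))
  obtain ⟨Q, hQ, hQ0⟩ := exists_eq_pow_rootMultiplicity_mul_and_not_dvd P hP0 w0
  set m := P.rootMultiplicity w0 with hm
  have hQw : Q.eval w0 ≠ 0 := by
    intro h; exact hQ0 (dvd_iff_isRoot.2 h)
  have hQne : Q ≠ 0 := by rintro rfl; simp at hQw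
  have hmpos : 1 ≤ m := (rootMultiplicity_pos hP0).2 hw0
  have hsum : k = m + Q.natDegree := by
    rw [← hdeg]
    conv_lhs => rw [hQ]
    rw [natDegree_mul (pow_ne_zero _ (X_sub_C_ne_zero w0)) hQne, natDegree_pow, natDegree_X_sub_C,
      mul_one]
  have hQd : Q.natDegree ≠ 0 := by
    intro hz
    obtain ⟨y, hy⟩ := natDegree_eq_zero.1 hz
    have hmk : m = k := by omega
    have hyne : y ≠ 0 := by rintro rfl; simp at hy; exact hQne hy.symm
    rw [← hy, hmk] at hQ
    have h1 := hcoef (k-1) (by omega)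
    rw [hQ, coeff_mul_C, sub_eq_add_neg, ← C_neg, coeff_X_add_C_pow, hc] at h1
    have hw : w0 = 0 := by
      rw [show k - (k-1) = 1 by omega, pow_one] at h1
      have hch : ((k.choose (k-1) : ℕ) : ℂ) ≠ 0 := by
        exact_mod_cast (Nat.choose_pos (by omega)).ne'
      simpa [hyne, hch] using h1
    have h2 := hcoef i0 hi0
    rw [hQ, hw, coeff_mul_C] at h2
    simp [coeff_X_pow, hi0.ne] at h2
    exact hci h2.symm
  obtain ⟨w1, hw1⟩ := IsAlgClosed.exists_root Q (by
    rw [degree_eq_natDegree hQne]; exact_mod_cast hQd)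
  refine ⟨w0, w1, ?_, ?_, ?_, ?_, m, hmpos, by omega, ?_⟩
  · rintro rfl; exact hQw hw1
  · rw [← hev]; exact hw0
  · rw [← hev, hQ, eval_mul, hw1.eq_zero, mul_zero]
  · intro w2
    simp only [← hev]
    have hfin : ((P.roots.toFinset : Set ℂ) \ {w2}).Finite := (Finset.finite_toSet _).subset Set.sdiff_subset
    rw [eventually_nhdsWithin_iff]
    filter_upwards [hfin.isClosed.isOpen_compl.mem_nhds (by simp : w2 ∈ _)] with w hw hne h
    apply hw
    refine ⟨?_, hne⟩
    simpa [hP0] using h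
  · simp only [← hev]
    have han : ∀ R : ℂ[X], AnalyticAt ℂ (fun w => R.eval (w + w0)) 0 := by
      intro R
      have : Differentiable ℂ (fun w => R.eval (w + w0)) := by fun_prop
      exact this.analyticAt 0
    rw [(han P).analyticOrderAt_eq_natCast]
    refine ⟨fun w => Q.eval (w + w0), han Q, by simpa using hQw, Eventually.of_forall fun w => ?_⟩
    simp only
    conv_lhs => rw [hQ]
    simp

theorem asz_hurwitz {H : ℂ × ℂ → ℂ} {w0 : ℂ} (hH : AnalyticAt ℂ H (w0, 0)) (h0 : H (w0, 0) = 0)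
    (hne : ∀ᶠ w in nhdsWithin w0 {w0}ᶜ, H (w, 0) ≠ 0) {ε : ℝ} (hε : 0 < ε) :
    ∀ᶠ s in nhds (0:ℂ), ∃ w, ‖w - w0‖ ≤ ε ∧ H (w, s) = 0 := by
  obtain ⟨r1, hr1, hA⟩ := Metric.eventually_nhds_iff_ball.1 hH.eventually_analyticAt
  rw [eventually_nhdsWithin_iff] at hne
  obtain ⟨r2, hr2, hN⟩ := Metric.eventually_nhds_iff_ball.1 hne
  obtain ⟨r, hr, hrε, hrr1, hrr2⟩ : ∃ r > 0, r ≤ ε ∧ r < r1 ∧ r < r2 := by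
    refine ⟨min ε (min (r1/2) (r2/2)), by positivity, min_le_left _ _, ?_, ?_⟩
    · exact lt_of_le_of_lt ((min_le_right _ _).trans (min_le_left _ _)) (by linarith)
    · exact lt_of_le_of_lt ((min_le_right _ _).trans (min_le_right _ _)) (by linarith)
  have hAn : ∀ w ∈ Metric.closedBall w0 r, ∀ s ∈ Metric.ball (0:ℂ) r1, AnalyticAt ℂ H (w, s) := by
    intro w hw s hs
    refine hA _ ?_
    rw [Metric.mem_ball, Prod.dist_eq]
    exact max_lt (lt_of_le_of_lt hw hrr1) hs
  have hcs : IsCompact (Metric.sphere w0 r) := isCompact_sphere _ _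
  obtain ⟨x, hx, hmin⟩ := hcs.exists_isMinOn (NormedSpace.sphere_nonempty.2 hr.le)
    (f := fun w => ‖H (w, 0)‖) (by
      intro w hw
      refine ContinuousAt.continuousWithinAt ?_
      exact (asz_slice (hAn w (Metric.sphere_subset_closedBall hw) 0 (by simpa using hr1))).continuousAt.norm)
  set δ := ‖H (x, 0)‖ with hδ
  have hδpos : 0 < δ := by
    rw [hδ, norm_pos_iff]
    refine hN x ?_ ?_
    · rw [Metric.mem_ball, Metric.mem_sphere.1 hx]; exact hrr2
    · rintro rfl
      simp at hx; exact hr.ne hx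
  have hsph : ∀ᶠ s in nhds (0:ℂ), ∀ w ∈ Metric.sphere w0 r, δ / 2 < ‖H (w, s)‖ := by
    refine hcs.eventually_forall_of_forall_eventually ?_
    intro w hw
    have hc := (hAn w (Metric.sphere_subset_closedBall hw) 0 (by simpa using hr1)).continuousAt.norm
    have : δ / 2 < ‖H (w, 0)‖ := lt_of_lt_of_le (by linarith) (hmin hw)
    have h2 := hc.eventually_const_lt this
    have hsw : Tendsto (fun z : ℂ × ℂ => (z.2, z.1)) (nhds ((0:ℂ), w)) (nhds (w, (0:ℂ))) :=
      (continuous_swap (X := ℂ) (Y := ℂ)).tendsto (0, w)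
    exact hsw.eventually h2
  have hcen : ∀ᶠ s in nhds (0:ℂ), ‖H (w0, s)‖ < δ / 2 := by
    have hc : ContinuousAt (fun s => ‖H (w0, s)‖) 0 := by
      have : AnalyticAt ℂ (fun s => H (w0, s)) 0 := hH.comp₂ analyticAt_const analyticAt_id
      exact this.continuousAt.norm
    refine hc.eventually_lt_const ?_
    simp [h0, hδpos]
  filter_upwards [hsph, hcen, Metric.ball_mem_nhds (0:ℂ) hr1] with s hs1 hs2 hs3
  by_contra hcon
  push Not at hcon
  have hnz : ∀ w ∈ Metric.closedBall w0 r, H (w, s) ≠ 0 := by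
    intro w hw
    exact hcon w (by rw [← dist_eq_norm]; exact le_trans hw hrε)
  have hd : DiffContOnCl ℂ (fun w => (H (w, s))⁻¹) (Metric.ball w0 r) := by
    refine DifferentiableOn.diffContOnCl ?_
    rw [closure_ball _ hr.ne']
    intro w hw
    exact ((asz_slice (hAn w hw s hs3)).differentiableAt.inv (hnz w hw)).differentiableWithinAt
  have hb := Complex.norm_le_of_forall_mem_frontier_norm_le Metric.isBounded_ball hd
    (C := (δ/2)⁻¹) (by
      intro w hw
      rw [frontier_ball _ hr.ne'] at hw
      rw [norm_inv]
      exact inv_anti₀ (by positivity) (hs1 w hw).le) (z := w0) (subset_closure (Metric.mem_ball_self hr))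
  rw [norm_inv] at hb
  have hp : 0 < ‖H (w0, s)‖ := norm_pos_iff.2 (hnz w0 (Metric.mem_closedBall_self hr.le))
  have := (inv_le_inv₀ hp (by positivity)).1 hb
  linarith

theorem asz_pull {a : ℂ → ℂ} (ha : AnalyticAt ℂ a 0) {N q : ℕ} (hq : 1 ≤ q)
    (h : (N : ℕ∞) ≤ q * analyticOrderAt a 0) :
    ∃ b : ℂ → ℂ, AnalyticAt ℂ b 0 ∧ (∀ᶠ s in nhds 0, a (s ^ q) = s ^ N * b s) ∧
      ((N : ℕ∞) = q * analyticOrderAt a 0 → b 0 ≠ 0) ∧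
      ((∀ᶠ t in nhds 0, a t = 0) → b 0 = 0) := by
  have ht : Tendsto (fun s : ℂ => s ^ q) (nhds 0) (nhds 0) := by
    have : Continuous (fun s : ℂ => s ^ q) := by fun_prop
    have h := this.tendsto 0
    rwa [zero_pow (by omega)] at h
  by_cases htop : analyticOrderAt a 0 = ⊤
  · refine ⟨fun _ => 0, analyticAt_const, ?_, ?_, fun _ => rfl⟩
    · filter_upwards [ht.eventually (analyticOrderAt_eq_top.1 htop)] with s hs
      simpa using hs
    · intro h2
      rw [htop, ENat.mul_top (by exact_mod_cast (by omega : q ≠ 0))] at h2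
      exact absurd h2 (ENat.natCast_ne_top _)
  · obtain ⟨n, hn⟩ := ENat.ne_top_iff_exists.1 htop
    rw [← hn] at h ⊢
    obtain ⟨g, hg, hg0, hge⟩ := (ha.analyticOrderAt_eq_natCast).1 hn.symm
    have hNn : N ≤ q * n := by exact_mod_cast h
    refine ⟨fun s => s ^ (q * n - N) * g (s ^ q), ?_, ?_, ?_, ?_⟩
    · refine (analyticAt_id.pow _).mul (AnalyticAt.comp (g := g) ?_ (analyticAt_id.pow _))
      simpa [zero_pow (by omega : q ≠ 0)] using hg
    · filter_upwards [ht.eventually hge] with s hs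
      rw [hs, sub_zero, smul_eq_mul, ← mul_assoc, ← pow_add, ← pow_mul, Nat.add_sub_cancel' hNn]
    · intro h2
      have : N = q * n := by exact_mod_cast h2
      simpa [this, zero_pow (by omega : q ≠ 0)] using hg0
    · intro h2
      exact absurd (analyticOrderAt_eq_top.2 h2) htop

/-- blow-up -/
noncomputable def aszH (k : ℕ) (b : ℕ → ℂ → ℂ) (u : ℂ × ℂ → ℂ) (p q : ℕ) : ℂ × ℂ → ℂ :=
  fun v => ∑ i ∈ Finset.range k, b i v.2 * v.1 ^ i + v.1 ^ k * u (v.2 ^ p * v.1, v.2 ^ q)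

theorem aszH_analytic {k : ℕ} {b : ℕ → ℂ → ℂ} {u : ℂ × ℂ → ℂ} {p q : ℕ} (hp : 1 ≤ p) (hq : 1 ≤ q)
    (hb : ∀ i < k, AnalyticAt ℂ (b i) 0) (hu : AnalyticAt ℂ u 0) (w : ℂ) :
    AnalyticAt ℂ (aszH k b u p q) (w, 0) := by
  unfold aszH
  refine AnalyticAt.add ?_ ?_
  · refine Finset.analyticAt_fun_sum _ fun i hi => ?_
    exact (AnalyticAt.comp (g := b i) (f := fun v : ℂ × ℂ => v.2) (x := (w, 0))
      (hb i (Finset.mem_range.1 hi)) analyticAt_snd).mul (analyticAt_fst.pow _)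
  · refine (analyticAt_fst.pow _).mul ?_
    refine AnalyticAt.comp₂ (h := u) ?_ ((analyticAt_snd.pow _).mul analyticAt_fst) (analyticAt_snd.pow _)
    simp only [zero_pow (by omega : q ≠ 0), zero_pow (by omega : p ≠ 0), zero_mul]
    exact hu

theorem aszH_zero {k : ℕ} {b : ℕ → ℂ → ℂ} {u : ℂ × ℂ → ℂ} {p q : ℕ} (hp : 1 ≤ p) (hq : 1 ≤ q)
    (w : ℂ) :
    aszH k b u p q (w, 0) = ∑ i ∈ Finset.range k, b i 0 * w ^ i + w ^ k * u 0 := by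
  simp only [aszH, zero_pow (by omega : q ≠ 0), zero_pow (by omega : p ≠ 0), zero_mul]
  rfl

theorem aszH_id {k : ℕ} {a b : ℕ → ℂ → ℂ} {u : ℂ × ℂ → ℂ} {p q : ℕ}
    (h : ∀ i < k, ∀ᶠ s in nhds 0, a i (s ^ q) = s ^ (p * (k - i)) * b i s) :
    ∀ᶠ s in nhds (0:ℂ), ∀ w, ∑ i ∈ Finset.range k, a i (s ^ q) * (s ^ p * w) ^ i +
      (s ^ p * w) ^ k * u (s ^ p * w, s ^ q) = s ^ (p * k) * aszH k b u p q (w, s) := by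
  have h2 : ∀ᶠ s in nhds (0:ℂ), ∀ i ∈ Finset.range k, a i (s ^ q) = s ^ (p * (k - i)) * b i s := by
    rw [Filter.eventually_all_finset]
    intro i hi
    exact h i (Finset.mem_range.1 hi)
  filter_upwards [h2] with s hs w
  simp only [aszH]
  rw [mul_add, Finset.mul_sum]
  congr 1
  · refine Finset.sum_congr rfl fun i hi => ?_
    have hik := Finset.mem_range.1 hi
    rw [hs i hi, mul_pow, ← pow_mul]
    have : p * k = p * (k - i) + p * i := by rw [← mul_add, Nat.sub_add_cancel hik.le]
    rw [this, pow_add]; ring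
  · rw [mul_pow, ← pow_mul]; ring

theorem asz_dir {G H : ℂ × ℂ → ℂ} {M k p q : ℕ} {ψ : ℂ → ℂ} (hp : 1 ≤ p) (hq : 1 ≤ q)
    (hreal : ∀ᶠ v in nhds (0 : ℂ × ℂ), v.2.im = 0 → v.2 ≠ 0 → G v = 0 →
      (v.2 ^ M * v.1 + ψ v.2).im = 0)
    {w0 w1 : ℂ} (hH0 : AnalyticAt ℂ H (w0, 0)) (hH1 : AnalyticAt ℂ H (w1, 0))
    (hz0 : H (w0, 0) = 0) (hz1 : H (w1, 0) = 0)
    (hn0 : ∀ᶠ w in nhdsWithin w0 {w0}ᶜ, H (w, 0) ≠ 0)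
    (hn1 : ∀ᶠ w in nhdsWithin w1 {w1}ᶜ, H (w, 0) ≠ 0)
    (hid : ∀ᶠ s in nhds (0:ℂ), ∀ w, G (s ^ p * w, s ^ q) = s ^ (p * k) * H (w, s))
    (η : ℂ) (σ : ℝ) (hσ : σ ≠ 0) (hη : η ^ q = σ) : (η ^ p * (w0 - w1)).im = 0 := by
  by_contra hne
  set δ := |(η ^ p * (w0 - w1)).im| with hδ
  have hδpos : 0 < δ := abs_pos.2 hne
  set A := ‖η ^ p‖ with hA
  have hA0 : 0 ≤ A := norm_nonneg _
  obtain ⟨ε, hε, hεδ⟩ : ∃ ε > 0, 2 * ε * A < δ := by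
    refine ⟨δ / (4 * (A + 1)), by positivity, ?_⟩
    have : 2 * (δ / (4 * (A + 1))) * A = δ * (A / (2 * (A + 1))) := by field_simp; ring
    rw [this]
    refine mul_lt_of_lt_one_right hδpos ?_
    rw [div_lt_one (by positivity)]; linarith
  obtain ⟨ρ, hρ, hball⟩ := Metric.eventually_nhds_iff_ball.1 hreal
  have hs : Tendsto (fun r : ℝ => (r:ℂ) * η) (nhdsWithin 0 (Set.Ioi 0)) (nhds 0) := by
    have : Continuous (fun r : ℝ => (r:ℂ) * η) := by fun_prop
    have h := this.tendsto 0
    simp only [Complex.ofReal_zero, zero_mul] at h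
    exact h.mono_left nhdsWithin_le_nhds
  set R := ‖w0‖ + ‖w1‖ + ε with hR
  have hsm1 : ∀ᶠ s in nhds (0:ℂ), ‖s ^ p‖ * R < ρ := by
    have : Continuous (fun s : ℂ => ‖s ^ p‖ * R) := by fun_prop
    refine (this.tendsto 0).eventually_lt_const ?_
    simpa [zero_pow (by omega : p ≠ 0)] using hρ
  have hsm2 : ∀ᶠ s in nhds (0:ℂ), ‖s ^ q‖ < ρ := by
    have : Continuous (fun s : ℂ => ‖s ^ q‖) := by fun_prop
    refine (this.tendsto 0).eventually_lt_const ?_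
    simpa [zero_pow (by omega : q ≠ 0)] using hρ
  have hall := hs.eventually (((((asz_hurwitz hH0 hz0 hn0 hε).and
    (asz_hurwitz hH1 hz1 hn1 hε)).and hid).and hsm1).and hsm2)
  obtain ⟨r, ⟨⟨⟨⟨⟨x0, hx0, hx0z⟩, ⟨x1, hx1, hx1z⟩⟩, hidr⟩, hm1⟩, hm2⟩, hr⟩ :=
    (hall.and self_mem_nhdsWithin).exists
  have hr : 0 < r := hr
  have htr : ((r:ℂ) * η) ^ q = ((r ^ q * σ : ℝ) : ℂ) := by
    rw [mul_pow, hη]; push_cast; ring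
  have hsp : ((r:ℂ) * η) ^ p = ((r ^ p : ℝ) : ℂ) * η ^ p := by
    rw [mul_pow]; push_cast; ring
  have hτ : r ^ q * σ ≠ 0 := mul_ne_zero (pow_ne_zero _ hr.ne') hσ
  have hx : ∀ x, ‖x‖ ≤ R → H (x, (r:ℂ) * η) = 0 →
      (((r ^ q * σ : ℝ) : ℂ) ^ M * (((r ^ p : ℝ) : ℂ) * η ^ p * x) + ψ ((r ^ q * σ : ℝ) : ℂ)).im = 0 := by
    intro x hxR hxz
    have h := hball (((r:ℂ) * η) ^ p * x, ((r:ℂ) * η) ^ q) (by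
      rw [mem_ball_zero_iff, Prod.norm_def]
      refine max_lt ?_ hm2
      rw [norm_mul]
      exact lt_of_le_of_lt (mul_le_mul_of_nonneg_left hxR (norm_nonneg _)) hm1)
    rw [htr, hsp] at h
    refine h (Complex.ofReal_im _) (Complex.ofReal_ne_zero.2 hτ) ?_
    rw [← htr, ← hsp, hidr x, hxz, mul_zero]
  have hb0 : ‖x0‖ ≤ R := by
    have : ‖x0‖ ≤ ‖x0 - w0‖ + ‖w0‖ := by simpa using norm_add_le (x0 - w0) w0
    have := norm_nonneg w1
    linarith
  have hb1 : ‖x1‖ ≤ R := by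
    have : ‖x1‖ ≤ ‖x1 - w1‖ + ‖w1‖ := by simpa using norm_add_le (x1 - w1) w1
    have := norm_nonneg w0
    linarith
  have e0 := hx x0 hb0 hx0z
  have e1 := hx x1 hb1 hx1z
  have e2 : (((r ^ q * σ) ^ M * r ^ p : ℝ) : ℂ) * (η ^ p * (x0 - x1)) =
      (((r ^ q * σ : ℝ) : ℂ) ^ M * (((r ^ p : ℝ) : ℂ) * η ^ p * x0) + ψ ((r ^ q * σ : ℝ) : ℂ)) -
      (((r ^ q * σ : ℝ) : ℂ) ^ M * (((r ^ p : ℝ) : ℂ) * η ^ p * x1) + ψ ((r ^ q * σ : ℝ) : ℂ)) := by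
    push_cast; ring
  have e3 := congrArg Complex.im e2
  rw [Complex.sub_im, e0, e1, sub_zero, Complex.im_ofReal_mul] at e3
  have e4 : (η ^ p * (x0 - x1)).im = 0 := by
    rcases mul_eq_zero.1 e3 with h | h
    · exact absurd h (mul_ne_zero (pow_ne_zero _ hτ) (pow_ne_zero _ hr.ne'))
    · exact h
  have e5 : η ^ p * (w0 - w1) = η ^ p * (x0 - x1) - η ^ p * ((x0 - w0) - (x1 - w1)) := by ring
  have e6 : δ ≤ A * (ε + ε) := by
    rw [hδ, e5, Complex.sub_im, e4, zero_sub, abs_neg]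
    refine (Complex.abs_im_le_norm _).trans ?_
    rw [norm_mul]
    refine mul_le_mul_of_nonneg_left ((norm_sub_le _ _).trans (add_le_add hx0 hx1)) hA0
  linarith

theorem asz_slope {G H : ℂ × ℂ → ℂ} {M k p q : ℕ} {ψ : ℂ → ℂ} (hp : 1 ≤ p) (hq : 1 ≤ q)
    (hreal : ∀ᶠ v in nhds (0 : ℂ × ℂ), v.2.im = 0 → v.2 ≠ 0 → G v = 0 →
      (v.2 ^ M * v.1 + ψ v.2).im = 0)
    {w0 w1 : ℂ} (hne : w0 ≠ w1) (hH0 : AnalyticAt ℂ H (w0, 0)) (hH1 : AnalyticAt ℂ H (w1, 0))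
    (hz0 : H (w0, 0) = 0) (hz1 : H (w1, 0) = 0)
    (hn0 : ∀ᶠ w in nhdsWithin w0 {w0}ᶜ, H (w, 0) ≠ 0)
    (hn1 : ∀ᶠ w in nhdsWithin w1 {w1}ᶜ, H (w, 0) ≠ 0)
    (hid : ∀ᶠ s in nhds (0:ℂ), ∀ w, G (s ^ p * w, s ^ q) = s ^ (p * k) * H (w, s)) :
    q ∣ p := by
  have key := asz_dir hp hq hreal hH0 hH1 hz0 hz1 hn0 hn1 hid
  have h1 : (w0 - w1).im = 0 := by simpa using key 1 1 one_ne_zero (by simp)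
  have hq0 : (q : ℝ) ≠ 0 := by exact_mod_cast (by omega : q ≠ 0)
  have hq0c : (q : ℂ) ≠ 0 := by exact_mod_cast (by omega : q ≠ 0)
  have h2 := key (Complex.exp ((Real.pi / q : ℝ) * Complex.I)) (-1) (by norm_num) (by
    rw [← Complex.exp_nat_mul]
    push_cast
    rw [← mul_assoc, mul_div_cancel₀ _ hq0c, Complex.exp_pi_mul_I])
  have h3 : Complex.exp ((Real.pi / q : ℝ) * Complex.I) ^ p =
      Complex.exp ((p * (Real.pi / q) : ℝ) * Complex.I) := by
    rw [← Complex.exp_nat_mul]; push_cast; ring_nf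
  have hre : (w0 - w1).re ≠ 0 := by
    intro h
    exact hne (sub_eq_zero.1 (Complex.ext h h1))
  rw [h3, Complex.mul_im, h1, mul_zero, zero_add, Complex.exp_ofReal_mul_I_im] at h2
  have h4 : Real.sin (p * (Real.pi / q)) = 0 := by
    rcases mul_eq_zero.1 h2 with h | h
    · exact h
    · exact absurd h hre
  obtain ⟨n, hn⟩ := Real.sin_eq_zero_iff.1 h4
  have h5 : (n : ℝ) * q = p := by
    have hpi := Real.pi_ne_zero
    field_simp at hn
    linarith
  have h6 : (q : ℤ) ∣ (p : ℤ) := ⟨n, by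
    have : n * (q:ℤ) = p := by exact_mod_cast h5
    rw [← this]; ring⟩
  exact_mod_cast h6

theorem asz_key (k : ℕ) : ∀ (F : ℂ × ℂ → ℂ), AnalyticAt ℂ F 0 → 1 ≤ k →
    analyticOrderAt (fun z => F (z, 0)) 0 = k →
    (∃ (M : ℕ) (ψ : ℂ → ℂ), ∀ᶠ v in nhds (0 : ℂ × ℂ), v.2.im = 0 → v.2 ≠ 0 → F v = 0 →
      (v.2 ^ M * v.1 + ψ v.2).im = 0) →
    ∃ g : ℂ → ℂ, AnalyticAt ℂ g 0 ∧ g 0 = 0 ∧ ∀ᶠ t in nhds 0, F (g t, t) = 0 := by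
  induction k using Nat.strong_induction_on with
  | _ k ih =>
  intro F hF hk hord ⟨M, ψ, hreal⟩
  obtain ⟨φ, hφ, hφ0, a, u, ha, hu, hu0, ha0, hak, hexp⟩ := asz_normal hF hk hord
  by_cases hall : ∀ i < k, analyticOrderAt (a i) 0 = ⊤
  · refine ⟨φ, hφ, hφ0, ?_⟩
    filter_upwards [analyticOrderAt_eq_top.1 (hall 0 (by omega))] with t ht
    have := hexp 0 t
    rw [zero_add] at this
    rw [this, zero_pow (by omega), zero_mul, add_zero]
    refine Finset.sum_eq_zero fun i hi => ?_
    rcases Nat.eq_zero_or_pos i with h | h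
    · rw [h, ht, zero_mul]
    · rw [zero_pow (by omega), mul_zero]
  push Not at hall
  -- the shifted function
  set G : ℂ × ℂ → ℂ := fun v => F (v.1 + φ v.2, v.2) with hG
  have hshift : Tendsto (fun v : ℂ × ℂ => (v.1 + φ v.2, v.2)) (nhds 0) (nhds 0) := by
    have h1 : ContinuousAt (fun v : ℂ × ℂ => (v.1 + φ v.2, v.2)) 0 := by
      refine ContinuousAt.prodMk (continuousAt_fst.add ?_) continuousAt_snd
      exact ContinuousAt.comp (g := φ) hφ.continuousAt continuousAt_snd
    have h2 := h1.tendsto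
    simp only [Prod.fst_zero, Prod.snd_zero, hφ0, add_zero] at h2
    exact h2
  have hrealG : ∀ᶠ v in nhds (0 : ℂ × ℂ), v.2.im = 0 → v.2 ≠ 0 → G v = 0 →
      (v.2 ^ M * v.1 + (fun t => t ^ M * φ t + ψ t) v.2).im = 0 := by
    filter_upwards [hshift.eventually hreal] with v hv h1 h2 h3
    have := hv h1 h2 h3
    rw [← this]; congr 1; ring
  -- minimal slope
  let S := (Finset.range k).filter (fun i => analyticOrderAt (a i) 0 ≠ ⊤)
  have hS : S.Nonempty := by
    obtain ⟨i, hi, hi2⟩ := hall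
    exact ⟨i, by simp [S, hi, hi2]⟩
  obtain ⟨i0, hi0S, hmin⟩ := S.exists_min_image
    (fun i => ((analyticOrderAt (a i) 0).toNat : ℚ) / ((k - i : ℕ) : ℚ)) hS
  obtain ⟨hi0, hi0t⟩ : i0 < k ∧ analyticOrderAt (a i0) 0 ≠ ⊤ := by simpa [S] using hi0S
  set p := (analyticOrderAt (a i0) 0).toNat with hpdef
  set q := k - i0 with hqdef
  have hpo : analyticOrderAt (a i0) 0 = (p : ℕ∞) := (ENat.natCast_toNat hi0t).symm
  have hq : 1 ≤ q := by omega
  have hp : 1 ≤ p := by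
    rw [Nat.one_le_iff_ne_zero]
    intro h
    rw [h] at hpo
    exact ((ha i0).analyticOrderAt_ne_zero.2 (ha0 i0 hi0)) (by simpa using hpo)
  have hslope : ∀ i < k, ((p * (k - i) : ℕ) : ℕ∞) ≤ q * analyticOrderAt (a i) 0 := by
    intro i hi
    by_cases ht : analyticOrderAt (a i) 0 = ⊤
    · rw [ht, ENat.mul_top (by exact_mod_cast (by omega : q ≠ 0))]; exact le_top
    · have h := hmin i (by simp [S, hi, ht])
      have hki : (0:ℚ) < ((k - i : ℕ) : ℚ) := by exact_mod_cast (by omega : 0 < k - i)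
      have hqq : (0:ℚ) < (q : ℚ) := by exact_mod_cast hq
      rw [div_le_div_iff₀ hqq hki] at h
      rw [← ENat.natCast_toNat ht]
      have h2 : p * (k - i) ≤ (analyticOrderAt (a i) 0).toNat * q := by exact_mod_cast h
      rw [mul_comm] at h2
      have h3 : p * (k - i) ≤ q * (analyticOrderAt (a i) 0).toNat := by linarith
      exact_mod_cast h3
  -- general blow-up
  have blow : ∀ p' q' : ℕ, 1 ≤ p' → 1 ≤ q' → p' * q = q' * p →
      (∀ i < k, ((p' * (k - i) : ℕ) : ℕ∞) ≤ q' * analyticOrderAt (a i) 0) →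
      ∃ H : ℂ × ℂ → ℂ, (∀ w, AnalyticAt ℂ H (w, 0)) ∧
        (∀ᶠ s in nhds (0:ℂ), ∀ w, G (s ^ p' * w, s ^ q') = s ^ (p' * k) * H (w, s)) ∧
        ∃ w0 w1, w0 ≠ w1 ∧ H (w0, 0) = 0 ∧ H (w1, 0) = 0 ∧
          (∀ w2, ∀ᶠ w in nhdsWithin w2 {w2}ᶜ, H (w, 0) ≠ 0) ∧
          ∃ k', 1 ≤ k' ∧ k' < k ∧ analyticOrderAt (fun w => H (w + w0, 0)) 0 = (k' : ℕ) := by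
    intro p' q' hp' hq' hpq hle
    have hex : ∀ i, ∃ b : ℂ → ℂ, i < k → (AnalyticAt ℂ b 0 ∧
        (∀ᶠ s in nhds 0, a i (s ^ q') = s ^ (p' * (k - i)) * b s) ∧
        (((p' * (k - i) : ℕ) : ℕ∞) = q' * analyticOrderAt (a i) 0 → b 0 ≠ 0) ∧
        ((∀ᶠ t in nhds 0, a i t = 0) → b 0 = 0)) := by
      intro i
      by_cases hi : i < k
      · obtain ⟨b, hb⟩ := asz_pull (ha i) hq' (hle i hi)
        exact ⟨b, fun _ => hb⟩
      · exact ⟨0, fun h => absurd h hi⟩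
    choose b hb using hex
    obtain ⟨w0, w1, hne, hw0, hw1, hnz, k', hk1, hk2, hk3⟩ := asz_poly hk (c := fun i => b i 0)
      (u0 := u 0) hu0 ((hb (k-1) (by omega)).2.2.2 hak) hi0 ((hb i0 hi0).2.2.1 (by
        rw [hpo]; exact_mod_cast hpq))
    refine ⟨aszH k b u p' q', aszH_analytic hp' hq' (fun i hi => (hb i hi).1) hu, ?_, w0, w1, hne,
      ?_, ?_, ?_, k', hk1, hk2, ?_⟩
    · filter_upwards [aszH_id (u := u) (fun i hi => (hb i hi).2.1)] with s hs w
      rw [← hs w]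
      exact hexp _ _
    · rw [aszH_zero hp' hq']; exact hw0
    · rw [aszH_zero hp' hq']; exact hw1
    · intro w2
      simp only [aszH_zero hp' hq']
      exact hnz w2
    · simp only [aszH_zero hp' hq']
      exact hk3
  -- the slope is an integer
  have hdvd : q ∣ p := by
    obtain ⟨H, hHa, hHid, w0, w1, hne, hz0, hz1, hnz, -⟩ := blow p q hp hq (mul_comm _ _) hslope
    exact asz_slope (M := M) (ψ := fun t => t ^ M * φ t + ψ t) hp hq hrealG hne (hHa w0) (hHa w1) hz0 hz1 (hnz w0) (hnz w1) hHid
  obtain ⟨m, hm⟩ := hdvd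
  have hm1 : 1 ≤ m := by
    rw [Nat.one_le_iff_ne_zero]; rintro rfl; omega
  obtain ⟨H, hHa, hHid, w0, -, -, -, -, -, k', hk1, hk2, hk3⟩ := blow m 1 hm1 le_rfl
    (by rw [hm]; ring) (by
      intro i hi
      have h := hslope i hi
      by_cases ht : analyticOrderAt (a i) 0 = ⊤
      · rw [ht, ENat.mul_top (by simp)]; exact le_top
      · rw [← ENat.natCast_toNat ht] at h ⊢
        have h2 : p * (k - i) ≤ q * (analyticOrderAt (a i) 0).toNat := by exact_mod_cast h
        rw [hm, mul_assoc] at h2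
        have h3 := Nat.le_of_mul_le_mul_left h2 (by omega)
        rw [Nat.cast_one, one_mul]
        exact_mod_cast h3)
  simp only [pow_one] at hHid
  set K : ℂ × ℂ → ℂ := fun v => H (v.1 + w0, v.2) with hK
  have hKa : AnalyticAt ℂ K 0 := by
    refine AnalyticAt.comp₂ (h := H) ?_ (analyticAt_fst.add analyticAt_const) analyticAt_snd
    simpa using hHa w0
  have htail : Tendsto (fun v : ℂ × ℂ => (v.2 ^ m * (v.1 + w0), v.2)) (nhds 0) (nhds 0) := by
    have h1 : Continuous (fun v : ℂ × ℂ => (v.2 ^ m * (v.1 + w0), v.2)) := by fun_prop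
    have h2 := h1.tendsto 0
    simp only [Prod.fst_zero, Prod.snd_zero, zero_pow (by omega : m ≠ 0), zero_mul] at h2
    exact h2
  have hsnd : Tendsto (fun v : ℂ × ℂ => v.2) (nhds 0) (nhds 0) := continuous_snd.tendsto 0
  obtain ⟨g, hg, hg0, hgz⟩ := ih k' hk2 K hKa hk1 hk3 ⟨M + m,
    fun t => t ^ (M + m) * w0 + (t ^ M * φ t + ψ t), by
      filter_upwards [htail.eventually hrealG, hsnd.eventually hHid] with v hv hv2 h1 h2 h3
      have h4 := hv h1 h2 (by
        rw [hv2]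
        change _ * K v = 0
        rw [h3, mul_zero])
      rw [← h4]; congr 1; ring⟩
  refine ⟨fun t => t ^ m * (g t + w0) + φ t, ?_, ?_, ?_⟩
  · exact ((analyticAt_id.pow _).mul (hg.add analyticAt_const)).add hφ
  · simp [hφ0, zero_pow (by omega : m ≠ 0)]
  · filter_upwards [hgz, hHid] with t ht ht2
    have h := ht2 (g t + w0)
    have h5 : H (g t + w0, t) = 0 := ht
    rw [h5, mul_zero] at h
    exact h

/-- Analytic selection of real zeros. -/
theorem analytic_selection_of_real_zeros
    (F : ℂ × ℂ → ℂ) (U : Set (ℂ × ℂ)) (hU : U ∈ nhds ((0 : ℂ), (0 : ℂ)))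
    (hF : ∀ p ∈ U, AnalyticAt ℂ F p)
    (h0 : F (0, 0) = 0)
    (hreal : ∀ z t : ℂ, (z, t) ∈ U → F (z, t) = 0 → t.im = 0 → z.im = 0) :
    ∃ r > (0 : ℝ), ∃ g : ℂ → ℂ,
      (∀ t ∈ Metric.ball (0 : ℂ) r, AnalyticAt ℂ g t) ∧
      g 0 = 0 ∧
      (∀ t ∈ Metric.ball (0 : ℂ) r, F (g t, t) = 0) := by
  have hF0 : AnalyticAt ℂ F 0 := hF _ (mem_of_mem_nhds hU)
  have hs : AnalyticAt ℂ (fun z => F (z, 0)) 0 := asz_slice hF0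
  have htop : analyticOrderAt (fun z => F (z, 0)) 0 ≠ ⊤ := by
    intro h
    have h1 := analyticOrderAt_eq_top.1 h
    have h2 : ∀ᶠ z in nhds (0:ℂ), (z, (0:ℂ)) ∈ U := by
      have : Continuous (fun z : ℂ => (z, (0:ℂ))) := by fun_prop
      exact this.tendsto 0 hU
    have h3 : Tendsto (fun r : ℝ => (r:ℂ) * Complex.I) (nhdsWithin 0 (Set.Ioi 0)) (nhds 0) := by
      have : Continuous (fun r : ℝ => (r:ℂ) * Complex.I) := by fun_prop
      have h := this.tendsto 0
      simp only [Complex.ofReal_zero, zero_mul] at h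
      exact h.mono_left nhdsWithin_le_nhds
    obtain ⟨r, ⟨hr1, hr2⟩, hr⟩ := ((h3.eventually (h1.and h2)).and self_mem_nhdsWithin).exists
    have := hreal _ _ hr2 hr1 (by simp)
    have hr : 0 < r := hr
    simp at this
    exact hr.ne' this
  obtain ⟨k, hk⟩ := ENat.ne_top_iff_exists.1 htop
  have hk1 : 1 ≤ k := by
    rw [Nat.one_le_iff_ne_zero]
    rintro rfl
    exact (hs.analyticOrderAt_ne_zero.2 h0) hk.symm
  obtain ⟨g, hg, hg0, hgz⟩ := asz_key k F hF0 hk1 hk.symm ⟨0, 0, by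
    have hU' : ∀ᶠ v in nhds (0 : ℂ × ℂ), v ∈ U := hU
    filter_upwards [hU'] with v hv h1 _ h3
    simpa using hreal v.1 v.2 hv h3 h1⟩
  obtain ⟨r, hr, hall⟩ := Metric.eventually_nhds_iff_ball.1 (hg.eventually_analyticAt.and hgz)
  exact ⟨r, hr, g, fun t ht => (hall t ht).1, hg0, fun t ht => (hall t ht).2⟩
end
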